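/- arXiv:1705.00770 — 11 statements merged into one kernel-verified Lean document; each statement's English description precedes it below -/
import Mathlib

section
/- Let C be an [n,l,d] linear code over F_q (q = p^e, p prime) with generator matrix G, and let 0 ≤ k < e. Then C is Galois LCD (with respect to the k-Galois inner product) if and only if the l×l matrix G(G^{(p^{e-k})})^T is nonsingular. -/
open Finset Matrix

/-- The `k`-Galois dual (as a set): all vectors `x` with `∑ i, c i * (x i)^pk = 0`
for every `c ∈ C`, where `pk = p^k`. -/
def galoisDualSet {F : Type*} [Field F] {ι : Type*} [Fintype ι] (pk : ℕ)
    (C : Set (ι → F)) : Set (ι → F) :=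
  {x | ∀ c ∈ C, ∑ i, c i * x i ^ pk = 0}

/-- A vector is in the span of the rows of `G` iff it is of the form `u ᵥ* G`. -/
theorem mem_span_range_iff_exists_vecMul {R m n : Type*} [CommSemiring R] [Fintype m]
    (G : Matrix m n R) (x : n → R) :
    x ∈ Submodule.span R (Set.range G) ↔ ∃ u, u ᵥ* G = x := by
  have h := range_vecMulLinear G
  change x ∈ Submodule.span R (Set.range G.row) ↔ _
  rw [← h]
  rfl

/-- The Galois dual of the row space of `G` is the kernel of `x ↦ G *ᵥ (x ^ pk)`. -/
theorem mem_galoisDualSet_span_range_iff {F m n : Type*} [Field F] [Fintype m] [Fintype n]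
    (pk : ℕ) (G : Matrix m n F) (x : n → F) :
    x ∈ galoisDualSet pk (Submodule.span F (Set.range G) : Set (n → F)) ↔
      G *ᵥ (fun i => x i ^ pk) = 0 := by
  have key : ∀ u : m → F, ∑ i, (u ᵥ* G) i * x i ^ pk = u ⬝ᵥ (G *ᵥ fun i => x i ^ pk) := by
    intro u
    rw [Matrix.dotProduct_mulVec]
    rfl
  constructor
  · intro h
    refine dotProduct_eq_zero_iff.mp fun u => ?_
    rw [dotProduct_comm, ← key]
    exact h _ ((mem_span_range_iff_exists_vecMul G _).mpr ⟨u, rfl⟩)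
  · intro h c hc
    obtain ⟨u, rfl⟩ := (mem_span_range_iff_exists_vecMul G c).mp hc
    rw [key, h, dotProduct_zero]

/-- If `σ` inverts `a ↦ a ^ pk`, then `x ∈ ker (G *ᵥ · ^ pk)` iff `x ∈ ker (G.map σ)`. -/
theorem mulVec_pow_eq_zero_iff {F m n : Type*} [Field F] [Fintype n]
    (pk : ℕ) (σ : F →+* F) (hσ : ∀ a, σ (a ^ pk) = a) (G : Matrix m n F) (x : n → F) :
    G *ᵥ (fun i => x i ^ pk) = 0 ↔ G.map σ *ᵥ x = 0 := by
  simp only [funext_iff, Pi.zero_apply]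
  refine forall_congr' fun i => ?_
  rw [← map_eq_zero σ, RingHom.map_mulVec]
  simp only [Function.comp_def, hσ]

/-- An `[n,l,d]` linear code `C` over `F_q` (`q = p^e`) with generator matrix `G`
is Galois LCD with respect to the `k`-Galois inner product (`0 ≤ k < e`) iff the `l×l` matrix
`G (G^{(p^{e-k})})ᵀ` is nonsingular. -/
theorem stmt1 {p e k n l d : ℕ} (hp : p.Prime) (hk : k < e)
    {F : Type*} [Field F] [Fintype F] [DecidableEq F]
    (hcard : Fintype.card F = p ^ e)
    (C : Submodule F (Fin n → F)) (G : Matrix (Fin l) (Fin n) F)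
    (hG : C = Submodule.span F (Set.range G))
    (hdim : Module.finrank F C = l)
    (hd : IsLeast {w | ∃ c ∈ C, c ≠ 0 ∧ hammingNorm c = w} d) :
    ((C : Set (Fin n → F)) ∩ galoisDualSet (p ^ k) (C : Set (Fin n → F)) = {0}) ↔
      IsUnit (G * (G.map (fun a => a ^ p ^ (e - k)))ᵀ) := by
  have : Fact p.Prime := ⟨hp⟩
  have : CharP F p := charP_of_card_eq_prime_pow hcard
  have hσ : ∀ a : F, iterateFrobenius F p (e - k) (a ^ p ^ k) = a := by
    intro a
    rw [iterateFrobenius_def, ← pow_mul, ← pow_add, Nat.add_sub_cancel' hk.le, ← hcard,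
      FiniteField.pow_card]
  have hker : ∀ u : Fin l → F, u ᵥ* G ∈ galoisDualSet (p ^ k) (C : Set (Fin n → F)) ↔
      u ᵥ* (G * (G.map (fun a => a ^ p ^ (e - k)))ᵀ) = 0 := by
    intro u
    rw [hG, mem_galoisDualSet_span_range_iff, mulVec_pow_eq_zero_iff _ _ hσ,
      ← Matrix.vecMul_vecMul, Matrix.vecMul_transpose]
    rfl
  have hinj : Function.Injective fun u => u ᵥ* G := by
    rw [Matrix.vecMul_injective_iff, linearIndependent_iff_card_eq_finrank_span,
      Fintype.card_fin, Set.finrank]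
    change l = Module.finrank F (Submodule.span F (Set.range G))
    rw [← hG, hdim]
  rw [← Matrix.vecMul_injective_iff_isUnit]
  change _ ↔ Function.Injective (Matrix.vecMulLinear _)
  rw [injective_iff_map_eq_zero]
  constructor
  · intro h u hu
    have hx : u ᵥ* G ∈ (C : Set (Fin n → F)) ∩ galoisDualSet (p ^ k) (C : Set (Fin n → F)) :=
      ⟨hG ▸ (mem_span_range_iff_exists_vecMul G _).mpr ⟨u, rfl⟩, (hker u).mpr hu⟩
    rw [h] at hx
    exact hinj (hx.trans (Matrix.zero_vecMul G).symm)
  · intro h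
    refine Set.Subset.antisymm ?_ ?_
    · rintro x ⟨hx, hx'⟩
      rw [SetLike.mem_coe, hG, mem_span_range_iff_exists_vecMul] at hx
      obtain ⟨u, rfl⟩ := hx
      rw [h u ((hker u).mp hx'), Matrix.zero_vecMul]
      rfl
    · rintro x rfl
      refine ⟨C.zero_mem, ?_⟩
      have h0 := (hker 0).mpr (Matrix.zero_vecMul _)
      rwa [Matrix.zero_vecMul] at h0
end

section
/- Let α and β be distinct nonzero elements of the finite field F_q. Then a linear code C of length n over F_q is both α-constacyclic and β-constacyclic if and only if C = {0} or C = F_q^n. -/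
/-- The `λ`-constacyclic shift `(c₀, c₁, …, c_{n-1}) ↦ (λ c_{n-1}, c₀, …, c_{n-2})`. -/
def constaShift {F : Type*} [Field F] {n : ℕ} (lam : F) (c : Fin n → F) : Fin n → F :=
  fun i =>
    if (i : ℕ) = 0 then lam * c ⟨n - 1, by have := i.isLt; omega⟩
    else c ⟨(i : ℕ) - 1, by have := i.isLt; omega⟩

/-- A linear code is `λ`-constacyclic if it is closed under the `λ`-constacyclic shift. -/
def IsConstacyclic {F : Type*} [Field F] {n : ℕ} (lam : F)
    (C : Submodule F (Fin n → F)) : Prop :=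
  ∀ c ∈ C, constaShift lam c ∈ C

theorem constaShift_succ {F : Type*} [Field F] {n : ℕ} (lam : F) (c : Fin n → F) {i : ℕ}
    (hi : i + 1 < n) : constaShift lam c ⟨i + 1, hi⟩ = c ⟨i, by omega⟩ := by
  simp [constaShift]

theorem constaShift_single {F : Type*} [Field F] {n : ℕ} (lam : F) {i : ℕ} (hi : i + 1 < n) :
    constaShift lam (Pi.single (⟨i, by omega⟩ : Fin n) 1) = Pi.single ⟨i + 1, hi⟩ 1 := by
  funext j
  simp only [constaShift, Pi.single_apply, Fin.ext_iff]
  split_ifs <;> first | omega | simp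

theorem constaShift_sub_constaShift {F : Type*} [Field F] {n : ℕ} (α β : F)
    (c : Fin n → F) (hn : 0 < n) :
    constaShift α c - constaShift β c =
      ((α - β) * c ⟨n - 1, by omega⟩) • Pi.single (⟨0, hn⟩ : Fin n) (1 : F) := by
  funext j
  simp only [constaShift, Pi.single_apply, Fin.ext_iff, Pi.sub_apply, Pi.smul_apply, smul_eq_mul]
  split_ifs <;> ring

/-- Shifting a codeword moves any nonzero coordinate to the last position. -/
theorem IsConstacyclic.exists_last_ne_zero {F : Type*} [Field F] {n : ℕ} {lam : F}
    {C : Submodule F (Fin n → F)} (h : IsConstacyclic lam C) (hn : 0 < n) (k : ℕ) :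
    ∀ c ∈ C, ∀ i : Fin n, (i : ℕ) + k = n - 1 → c i ≠ 0 →
      ∃ d ∈ C, d ⟨n - 1, by omega⟩ ≠ 0 := by
  induction k with
  | zero =>
    intro c hc i hi hne
    have hlast : i = ⟨n - 1, Nat.sub_one_lt_of_lt hn⟩ := Fin.ext hi
    exact ⟨c, hc, hlast ▸ hne⟩
  | succ k ih =>
    intro c hc i hi hne
    refine ih (constaShift lam c) (h c hc) ⟨i + 1, by omega⟩ (by simp only; omega) ?_
    rwa [constaShift_succ]

theorem IsConstacyclic.eq_top_of_single_zero_mem {F : Type*} [Field F] {n : ℕ} {lam : F}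
    {C : Submodule F (Fin n → F)} (h : IsConstacyclic lam C) (hn : 0 < n)
    (h0 : Pi.single (⟨0, hn⟩ : Fin n) (1 : F) ∈ C) : C = ⊤ := by
  have hs : ∀ (i : ℕ) (hi : i < n), Pi.single (⟨i, hi⟩ : Fin n) (1 : F) ∈ C := by
    intro i
    induction i with
    | zero => exact fun _ => h0
    | succ i ih =>
      intro hi
      rw [← constaShift_single lam hi]
      exact h _ (ih _)
  refine (Submodule.eq_top_iff').2 fun x => ?_
  rw [pi_eq_sum_univ' x]
  exact C.sum_mem fun i _ => C.smul_mem _ (hs i i.isLt)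

/-- For distinct nonzero `α, β ∈ F_q`, a linear code `C` of length `n` over `F_q`
is both `α`-constacyclic and `β`-constacyclic iff `C = {0}` or `C = F_q^n`. -/
theorem stmt4 {F : Type*} [Field F] {n : ℕ} (α β : F) (hα : α ≠ 0) (hβ : β ≠ 0)
    (hαβ : α ≠ β) (C : Submodule F (Fin n → F)) :
    (IsConstacyclic α C ∧ IsConstacyclic β C) ↔ (C = ⊥ ∨ C = ⊤) := by
  constructor
  · rintro ⟨h₁, h₂⟩
    refine or_iff_not_imp_left.2 fun hC => ?_
    obtain ⟨c, hc, hne⟩ := C.exists_mem_ne_zero_of_ne_bot hC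
    obtain ⟨i, hi⟩ := Function.ne_iff.1 hne
    have hn : 0 < n := i.pos
    obtain ⟨d, hd, hlast⟩ :=
      h₁.exists_last_ne_zero hn (n - 1 - i) c hc i (by omega) hi
    refine h₁.eq_top_of_single_zero_mem hn ?_
    have hsub := C.sub_mem (h₁ d hd) (h₂ d hd)
    rw [constaShift_sub_constaShift α β d hn] at hsub
    exact (C.smul_mem_iff (mul_ne_zero (sub_ne_zero.2 hαβ) hlast)).1 hsub
  · rintro (rfl | rfl)
    · constructor <;>
      · intro c hc
        rw [Submodule.mem_bot] at hc ⊢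
        subst hc
        funext j
        simp [constaShift]
    · exact ⟨fun _ _ => Submodule.mem_top, fun _ _ => Submodule.mem_top⟩
end

section
/- Let q = p^e (p prime), 0 ≤ k < e, and λ ∈ F_q^*. If λ^{1+p^{e-k}} ≠ 1, then every λ-constacyclic code C of length n over F_q is a Galois LCD code with respect to the k-Galois inner product, i.e., C ∩ C^{⊥_k} = {0}. -/
open Finset

theorem constaShift_apply_zero {F : Type*} [Field F] {m : ℕ} (lam : F) (c : Fin (m + 1) → F) :
    constaShift lam c 0 = lam * c (Fin.last m) := by
  simp [constaShift, Fin.last]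

theorem constaShift_apply_succ {F : Type*} [Field F] {m : ℕ} (lam : F) (c : Fin (m + 1) → F)
    (i : Fin m) : constaShift lam c i.succ = c i.castSucc := by
  simp [constaShift, Fin.castSucc, Fin.castAdd, Fin.castLE]

theorem constaShift_add {F : Type*} [Field F] {n : ℕ} (lam : F) (c d : Fin n → F) :
    constaShift lam (c + d) = constaShift lam c + constaShift lam d := by
  funext i
  simp only [constaShift, Pi.add_apply]
  split_ifs <;> ring

theorem constaShift_injective {F : Type*} [Field F] {m : ℕ} {lam : F} (hlam : lam ≠ 0) :
    Function.Injective (constaShift lam : (Fin (m + 1) → F) → Fin (m + 1) → F) := by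
  intro c d h
  funext i
  induction i using Fin.lastCases with
  | last =>
    have h0 := congrFun h 0
    rw [constaShift_apply_zero, constaShift_apply_zero] at h0
    exact mul_left_cancel₀ hlam h0
  | cast i =>
    have hi := congrFun h i.succ
    rwa [constaShift_apply_succ, constaShift_apply_succ] at hi

/-- The shifts for two constants differ only in the first coordinate. -/
theorem constaShift_eq_add_single {F : Type*} [Field F] {m : ℕ} (lam mu : F)
    (c : Fin (m + 1) → F) :
    constaShift lam c = constaShift mu c +
      ((lam - mu) * c (Fin.last m)) • (Pi.single 0 1 : Fin (m + 1) → F) := by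
  funext i
  cases i using Fin.cases with
  | zero => simp [constaShift_apply_zero]; ring
  | succ i => simp [constaShift_apply_succ]

theorem constaShift_single_castSucc {F : Type*} [Field F] {m : ℕ} (lam : F) (i : Fin m) :
    constaShift lam (Pi.single i.castSucc 1 : Fin (m + 1) → F) = Pi.single i.succ 1 := by
  funext j
  cases j using Fin.cases with
  | zero => simp [constaShift_apply_zero, (Fin.castSucc_lt_last i).ne']
  | succ j => simp [constaShift_apply_succ, Pi.single_apply]

theorem exists_mem_last_ne_zero {F : Type*} [Field F] {m : ℕ} {lam mu : F}
    {C D : Submodule F (Fin (m + 1) → F)} (hC : IsConstacyclic lam C) (hD : IsConstacyclic mu D)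
    (i : Fin (m + 1)) :
    ∀ x ∈ C ⊓ D, x i ≠ 0 → ∃ y ∈ C ⊓ D, y (Fin.last m) ≠ 0 := by
  induction i using Fin.reverseInduction with
  | last => exact fun x hx h => ⟨x, hx, h⟩
  | cast i ih =>
    intro x hx h
    by_cases hl : x (Fin.last m) = 0
    · refine ih (constaShift lam x) ⟨hC x hx.1, ?_⟩ (by rwa [constaShift_apply_succ])
      rw [constaShift_eq_add_single lam mu, hl]
      simpa using hD x hx.2
    · exact ⟨x, hx, hl⟩

/-- Constacyclic codes for distinct constants with nontrivial intersection span the whole space. -/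
theorem IsConstacyclic.sup_eq_top {F : Type*} [Field F] {m : ℕ} {lam mu : F} (hne : lam ≠ mu)
    {C D : Submodule F (Fin (m + 1) → F)} (hC : IsConstacyclic lam C) (hD : IsConstacyclic mu D)
    (hCD : C ⊓ D ≠ ⊥) : C ⊔ D = ⊤ := by
  obtain ⟨x, hx, hx0⟩ := Submodule.exists_mem_ne_zero_of_ne_bot hCD
  obtain ⟨i, hi⟩ := Function.ne_iff.mp hx0
  obtain ⟨y, hy, hyl⟩ := exists_mem_last_ne_zero hC hD i x hx hi
  have h0 : (Pi.single 0 1 : Fin (m + 1) → F) ∈ C ⊔ D := by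
    have hs := constaShift_eq_add_single lam mu y
    rw [← sub_eq_iff_eq_add'] at hs
    rw [← Submodule.smul_mem_iff _ (mul_ne_zero (sub_ne_zero.mpr hne) hyl), ← hs]
    exact Submodule.sub_mem _ (Submodule.mem_sup_left (hC y hy.1))
      (Submodule.mem_sup_right (hD y hy.2))
  have hshift : IsConstacyclic lam (C ⊔ D) := by
    intro w hw
    obtain ⟨c, hc, d, hd, rfl⟩ := Submodule.mem_sup.mp hw
    rw [constaShift_add, constaShift_eq_add_single lam mu d]
    exact Submodule.add_mem _ (Submodule.mem_sup_left (hC c hc))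
      (Submodule.add_mem _ (Submodule.mem_sup_right (hD d hd)) (Submodule.smul_mem _ _ h0))
  have hsingle : ∀ i, (Pi.single i 1 : Fin (m + 1) → F) ∈ C ⊔ D := by
    intro i
    induction i using Fin.induction with
    | zero => exact h0
    | succ i ih =>
      rw [← constaShift_single_castSucc lam]
      exact hshift _ ih
  rw [eq_top_iff, ← (Pi.basisFun F (Fin (m + 1))).span_eq, Submodule.span_le]
  rintro _ ⟨i, rfl⟩
  simpa using hsingle i

/-- The dual with respect to the form twisted by a ring endomorphism `f`, as a submodule. -/
def twistedDual {F : Type*} [Field F] {ι : Type*} [Fintype ι] (f : F →+* F)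
    (C : Submodule F (ι → F)) : Submodule F (ι → F) where
  carrier := {x | ∀ c ∈ C, ∑ i, c i * f (x i) = 0}
  zero_mem' := fun c _ => by simp
  add_mem' := fun {x y} hx hy c hc => by
    simp only [Pi.add_apply, map_add, mul_add, sum_add_distrib]
    rw [hx c hc, hy c hc, add_zero]
  smul_mem' := fun a x hx c hc => by
    simp only [Pi.smul_apply, smul_eq_mul, map_mul, mul_left_comm _ (f a), ← mul_sum]
    rw [hx c hc, mul_zero]

theorem IsConstacyclic.twistedDual {F : Type*} [Field F] {m : ℕ} {lam mu : F} (hlam : lam ≠ 0)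
    (f : F →+* F) (hmu : lam * f mu = 1) {C : Submodule F (Fin (m + 1) → F)} [Finite C]
    (hC : IsConstacyclic lam C) : IsConstacyclic mu (twistedDual f C) := by
  intro d hd c hc
  have hsurj : Function.Surjective (fun c : C => (⟨constaShift lam c, hC c c.2⟩ : C)) := by
    apply Finite.surjective_of_injective
    intro a b hab
    exact Subtype.ext (constaShift_injective hlam (congrArg Subtype.val hab))
  obtain ⟨⟨c', hc'⟩, h⟩ := hsurj ⟨c, hc⟩
  obtain rfl : constaShift lam c' = c := congrArg Subtype.val h
  have h0 := hd c' hc'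
  rw [Fin.sum_univ_castSucc] at h0
  rw [Fin.sum_univ_succ]
  simp only [constaShift_apply_zero, constaShift_apply_succ, map_mul]
  linear_combination h0 + c' (Fin.last m) * f (d (Fin.last m)) * hmu

theorem card_mul_card_twistedDual_le {F : Type*} [Field F] [Finite F] {ι : Type*} [Fintype ι]
    (f : F →+* F) (C : Submodule F (ι → F)) :
    Nat.card C * Nat.card (twistedDual f C) ≤ Nat.card (ι → F) := by
  classical
  let g : twistedDual f C → C.dualAnnihilator := fun d =>
    ⟨Fintype.linearCombination F (fun i => f (d.1 i)), by
      rw [Submodule.mem_dualAnnihilator]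
      intro c hc
      simpa [Fintype.linearCombination_apply] using d.2 c hc⟩
  have hg : Function.Injective g := by
    intro a b hab
    ext i
    have h := LinearMap.congr_fun (congrArg Subtype.val hab) (Pi.single i 1)
    simp only [g, Fintype.linearCombination_apply_single, one_smul] at h
    exact f.injective h
  have : Finite (Module.Dual F (ι → F)) := Module.finite_of_finite F
  calc
    _ ≤ Nat.card C * Nat.card C.dualAnnihilator :=
      Nat.mul_le_mul_left _ (Nat.card_le_card_of_injective g hg)
    _ = Nat.card (ι → F) := by
      rw [Module.natCard_eq_pow_finrank (K := F) (V := C),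
        Module.natCard_eq_pow_finrank (K := F) (V := C.dualAnnihilator),
        Module.natCard_eq_pow_finrank (K := F) (V := ι → F), ← pow_add,
        Subspace.finrank_add_finrank_dualAnnihilator_eq]

theorem inf_eq_bot_of_card_mul_card_le {F V : Type*} [Ring F] [AddCommGroup V] [Module F V]
    [Finite V] {C D : Submodule F V} (hcard : Nat.card C * Nat.card D ≤ Nat.card V)
    (htop : C ⊔ D = ⊤) : C ⊓ D = ⊥ := by
  have hsurj : Function.Surjective (fun z : C × D => (z.1 : V) + z.2) := by
    intro v
    obtain ⟨c, hc, d, hd, h⟩ := Submodule.mem_sup.mp (htop ▸ Submodule.mem_top : v ∈ C ⊔ D)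
    exact ⟨(⟨c, hc⟩, ⟨d, hd⟩), h⟩
  have hinj := (hsurj.bijective_of_nat_card_le (by rwa [Nat.card_prod])).injective
  rw [eq_bot_iff]
  rintro x ⟨hxC, hxD⟩
  have h := @hinj (⟨x, hxC⟩, -⟨x, hxD⟩) (0, 0) (by simp)
  exact congrArg (fun z : C × D => (z.1 : V)) h

/-- If `λ^{1+p^{e-k}} ≠ 1`, then every `λ`-constacyclic code `C` of length `n`
over `F_q` (`q = p^e`, `0 ≤ k < e`) is Galois LCD: `C ∩ C^{⊥_k} = {0}`. -/
theorem stmt6 {p e k n : ℕ} (hp : p.Prime) (hk : k < e)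
    {F : Type*} [Field F] [Fintype F] (hcard : Fintype.card F = p ^ e)
    (lam : F) (hlam : lam ≠ 0)
    (hlam1 : lam ^ (1 + p ^ (e - k)) ≠ 1)
    (C : Submodule F (Fin n → F)) (hC : IsConstacyclic lam C) :
    (C : Set (Fin n → F)) ∩ galoisDualSet (p ^ k) (C : Set (Fin n → F)) = {0} := by
  have : Fact p.Prime := ⟨hp⟩
  have : CharP F p := by
    obtain ⟨r, hr⟩ := CharP.exists F
    obtain ⟨s, hr', hs⟩ := FiniteField.card F r
    rw [hcard] at hs
    obtain rfl : p = r := (Nat.prime_dvd_prime_iff_eq hp hr').mp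
      (hp.dvd_of_dvd_pow (hs ▸ dvd_pow_self p (by omega)))
    exact hr
  cases n with
  | zero =>
    ext x
    simp only [Subsingleton.elim x 0, Set.mem_singleton_iff, iff_true]
    exact ⟨C.zero_mem, fun c _ => Finset.sum_empty⟩
  | succ m =>
    let f : F →+* F := iterateFrobenius F p k
    have hdual : galoisDualSet (p ^ k) (C : Set (Fin (m + 1) → F)) = twistedDual f C := rfl
    have hpow : (lam ^ p ^ (e - k)) ^ p ^ k = lam := by
      rw [← pow_mul, ← pow_add, Nat.sub_add_cancel hk.le, ← hcard, FiniteField.pow_card]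
    have hmu : lam * f (lam ^ p ^ (e - k))⁻¹ = 1 := by
      rw [map_inv₀, iterateFrobenius_def, hpow, mul_inv_cancel₀ hlam]
    have hne : lam ≠ (lam ^ p ^ (e - k))⁻¹ := by
      intro h
      apply hlam1
      rw [pow_add, pow_one]
      nth_rw 1 [h]
      exact inv_mul_cancel₀ (pow_ne_zero _ hlam)
    have hbot : C ⊓ twistedDual f C = ⊥ := by
      by_contra h
      exact h (inf_eq_bot_of_card_mul_card_le (card_mul_card_twistedDual_le f C)
        (hC.sup_eq_top hne (hC.twistedDual hlam f hmu) h))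
    rw [hdual, ← Submodule.coe_inf, hbot, Submodule.bot_coe]
end

section
/- Let q = p^e (p prime), 0 ≤ k < e, λ ∈ F_q^* with order r and λ^{1+p^{e-k}} = 1, and n coprime to q. Let C_P be the λ-constacyclic code of length n over F_q with defining set P ⊆ 1 + rZ_{rn}. Then C_P is a Galois LCD code (with respect to the k-Galois inner product) if and only if −p^k·P = P (modulo rn). -/
open Finset Polynomial

/-- The subset `1 + rZ_{rn} = {1 + rt : t = 0, 1, …, n-1}` of `Z_{rn}`. -/
def oneCoset (r n : ℕ) : Set (ZMod (r * n)) :=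
  {x | ∃ t : ℕ, t < n ∧ x = 1 + (r : ZMod (r * n)) * (t : ZMod (r * n))}

/-- The constacyclic code of length `n` over `F` whose defining set is `P`: all vectors `c`
such that `θ^i` is a root of `c₀ + c₁X + ⋯ + c_{n-1}X^{n-1}` for every `i ∈ P`. -/
noncomputable def codeOfDefSet (F : Type*) {E : Type*} [Field F] [Field E] [Algebra F E]
    (n : ℕ) {N : ℕ} (θ : E) (P : Set (ZMod N)) : Set (Fin n → F) :=
  {c | ∀ i ∈ P, Polynomial.aeval (θ ^ i.val)
      (∑ j : Fin n, Polynomial.C (c j) * X ^ (j : ℕ)) = 0}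

theorem exists_algebraMap_eq_of_pow_card_eq_self {F E : Type*} [Field F] [Fintype F] [Field E]
    [Algebra F E] (y : E) (hy : y ^ Fintype.card F = y) : ∃ a, algebraMap F E a = y := by
  by_contra! h
  refine FiniteField.X_pow_card_sub_X_ne_zero E (Fintype.one_lt_card (α := F))
    (Polynomial.eq_zero_of_natDegree_lt_card_of_eval_eq_zero _
      (f := fun o : Option F => o.elim y (algebraMap F E)) ?_ ?_ ?_)
  · rintro (_ | a) (_ | b) hab
    · rfl
    · exact absurd hab.symm (h b)
    · exact absurd hab (h a)
    · exact congrArg some ((algebraMap F E).injective hab)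
  · rintro (_ | a)
    · simp [hy]
    · simp [← map_pow, FiniteField.pow_card]
  · rw [FiniteField.X_pow_card_sub_X_natDegree_eq E Fintype.one_lt_card]
    simp

theorem exists_algebraMap_eq_sum_addChar {F E : Type*} [Field F] [Fintype F] [Field E]
    [Algebra F E] {p e N : ℕ} [ExpChar E p] (hcard : Fintype.card F = p ^ e)
    (ψ : AddChar (ZMod N) E) (hu : IsUnit ((p : ZMod N) ^ e)) (S : Finset (ZMod N))
    (hS : ∀ x, (p : ZMod N) ^ e * x ∈ S ↔ x ∈ S) (b : ZMod N) :
    ∃ a, algebraMap F E a = ∑ j ∈ S, ψ (j * b) := by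
  apply exists_algebraMap_eq_of_pow_card_eq_self
  rw [hcard, sum_pow_char_pow]
  refine Finset.sum_bij (fun j _ => (p : ZMod N) ^ e * j) (fun j hj => (hS j).2 hj)
    (fun i _ j _ hij => hu.mul_left_cancel hij) (fun j hj => ?_) (fun j _ => ?_)
  · obtain ⟨v, hv⟩ := hu
    have hj' : (p : ZMod N) ^ e * (↑v⁻¹ * j) = j := by rw [← hv, Units.mul_inv_cancel_left]
    exact ⟨_, (hS _).1 (by rwa [hj']), hj'⟩
  · rw [← AddChar.map_nsmul_eq_pow, nsmul_eq_mul, Nat.cast_pow, mul_assoc]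

theorem mem_codeOfDefSet_iff {F E : Type*} [Field F] [Field E] [Algebra F E] {n N : ℕ} {θ : E}
    {P : Set (ZMod N)} {ψ : AddChar (ZMod N) E} (hψ : ∀ x, ψ x = θ ^ x.val) {c : Fin n → F} :
    c ∈ codeOfDefSet F n θ P ↔
      ∀ l ∈ P, ∑ i : Fin n, algebraMap F E (c i) * ψ (l * (i : ℕ)) = 0 := by
  refine forall₂_congr fun l _ => ?_
  rw [map_sum]
  refine Eq.congr (Finset.sum_congr rfl fun i _ => ?_) rfl
  rw [map_mul, aeval_C, map_pow, aeval_X, ← hψ, ← AddChar.map_nsmul_eq_pow, nsmul_eq_mul, mul_comm l]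

theorem sum_addChar_mul_natCast {E : Type*} [Field E] {n N : ℕ} {ψ : AddChar (ZMod N) E}
    (hψ : Function.Injective ψ) {z : ZMod N} (hz : (n : ZMod N) * z = 0) :
    ∑ i : Fin n, ψ (z * (i : ℕ)) = if z = 0 then (n : E) else 0 := by
  split_ifs with h
  · simp [h]
  · have h1 : (1 : E) - ψ z ≠ 0 := fun h0 =>
      h (hψ (by rw [AddChar.map_zero_eq_one]; exact (sub_eq_zero.1 h0).symm))
    have h2 := mul_neg_geom_sum (ψ z) n
    rw [← AddChar.map_nsmul_eq_pow, nsmul_eq_mul, hz, AddChar.map_zero_eq_one, sub_self] at h2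
    rw [← (mul_eq_zero.1 h2).resolve_left h1, Finset.sum_range]
    exact Finset.sum_congr rfl fun i _ => by
      rw [← AddChar.map_nsmul_eq_pow, nsmul_eq_mul, mul_comm]

theorem ZMod.natCast_mul_eq_zero_of_castHom_eq_zero {r n : ℕ} [NeZero (r * n)] {z : ZMod (r * n)}
    (hz : ZMod.castHom (dvd_mul_right r n) (ZMod r) z = 0) : (n : ZMod (r * n)) * z = 0 := by
  rw [← ZMod.natCast_zmod_val z, map_natCast, ZMod.natCast_eq_zero_iff] at hz
  rw [← ZMod.natCast_zmod_val z, ← Nat.cast_mul, ZMod.natCast_eq_zero_iff]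
  exact (mul_dvd_mul_right hz n).trans (mul_comm _ n).dvd

theorem sum_sum_addChar_mul {E : Type*} [Field E] {r n : ℕ} [NeZero (r * n)]
    {ψ : AddChar (ZMod (r * n)) E} (hψ : Function.Injective ψ) (S : Finset (ZMod (r * n)))
    (hS : ∀ j ∈ S, ZMod.castHom (dvd_mul_right r n) (ZMod r) j = 1) (b : ZMod (r * n))
    {l : ZMod (r * n)} (hl : ZMod.castHom (dvd_mul_right r n) (ZMod r) l = 1) :
    ∑ i : Fin n, (∑ j ∈ S, ψ (j * (b - (i : ℕ)))) * ψ (l * (i : ℕ)) =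
      if l ∈ S then (n : E) * ψ (l * b) else 0 := by
  simp_rw [Finset.sum_mul]
  rw [Finset.sum_comm]
  have key : ∀ j ∈ S, ∑ i : Fin n, ψ (j * (b - (i : ℕ))) * ψ (l * (i : ℕ)) =
      if l = j then (n : E) * ψ (l * b) else 0 := fun j hj => by
    have h := sum_addChar_mul_natCast hψ
      (ZMod.natCast_mul_eq_zero_of_castHom_eq_zero (z := l - j) (by rw [map_sub, hl, hS j hj, sub_self]))
    have h' : ∀ i : Fin n, ψ (j * (b - (i : ℕ))) * ψ (l * (i : ℕ)) =
        ψ ((l - j) * (i : ℕ)) * ψ (j * b) := fun i => by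
      rw [← AddChar.map_add_eq_mul, ← AddChar.map_add_eq_mul]
      congr 1
      ring
    simp_rw [h', ← Finset.sum_mul, h, sub_eq_zero]
    split_ifs with hlj
    · rw [hlj]
    · rw [zero_mul]
  rw [Finset.sum_congr rfl key, Finset.sum_ite_eq]

theorem eq_zero_of_forall_sum_addChar_eq_zero {E : Type*} [Field E] {r n : ℕ} [NeZero (r * n)]
    {ψ : AddChar (ZMod (r * n)) E} (hψ : Function.Injective ψ) {x : Fin n → E}
    (hx : ∀ l, ZMod.castHom (dvd_mul_right r n) (ZMod r) l = 1 →
      ∑ i : Fin n, x i * ψ (l * (i : ℕ)) = 0) : x = 0 := by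
  have hn : 0 < n := Nat.pos_of_ne_zero fun h => NeZero.ne (r * n) (by simp [h])
  have hr : 0 < r := Nat.pos_of_ne_zero fun h => NeZero.ne (r * n) (by simp [h])
  have hzero : ∑ i : Fin n, C (x i) * X ^ (i : ℕ) = (0 : E[X]) := by
    refine Polynomial.eq_zero_of_natDegree_lt_card_of_eval_eq_zero _
      (f := fun t : Fin n => ψ (1 + ((r * t : ℕ) : ZMod (r * n)))) ?_ (fun t => ?_) ?_
    · intro s t hst
      have h := add_left_cancel (hψ hst)
      rw [ZMod.natCast_eq_natCast_iff'] at h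
      rw [Nat.mod_eq_of_lt (Nat.mul_lt_mul_of_pos_left s.2 hr),
        Nat.mod_eq_of_lt (Nat.mul_lt_mul_of_pos_left t.2 hr)] at h
      exact Fin.ext (Nat.eq_of_mul_eq_mul_left hr h)
    · rw [eval_finsetSum, ← hx (1 + ((r * t : ℕ) : ZMod (r * n)))
        (by rw [map_add, map_one, map_natCast, Nat.cast_mul, ZMod.natCast_self, zero_mul, add_zero])]
      refine Finset.sum_congr rfl fun i _ => ?_
      rw [eval_mul, eval_C, eval_pow, eval_X, ← AddChar.map_nsmul_eq_pow, nsmul_eq_mul,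
        mul_comm ((i : ℕ) : ZMod (r * n))]
    · rw [Fintype.card_fin]
      refine (Polynomial.natDegree_sum_le_of_forall_le (n := n - 1) _ _ fun i _ => ?_).trans_lt
        (Nat.sub_lt hn one_pos)
      exact (natDegree_C_mul_X_pow_le _ _).trans (by omega)
  funext i
  have h := congrArg (fun f => coeff f (i : ℕ)) hzero
  simpa [finsetSum_coeff, coeff_C_mul, coeff_X_pow, Fin.val_inj] using h

theorem Set.image_eq_self_iff_preimage_subset {α : Type*} [Finite α] {f : α → α}
    (hf : Function.Injective f) (P : Set α) : f '' P = P ↔ ∀ x, f x ∈ P → x ∈ P := by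
  have hb := Finite.injective_iff_bijective.1 hf
  constructor
  · intro h x hx
    rw [← h] at hx
    exact (hf.mem_set_image).1 hx
  · intro h
    refine (Set.eq_of_subset_of_ncard_le (fun y hy => ?_) ?_ (Set.toFinite _)).symm
    · obtain ⟨x, rfl⟩ := hb.2 y
      exact Set.mem_image_of_mem f (h x hy)
    · exact Set.ncard_image_le

/-- With `λ` of order `r`, `λ^{1+p^{e-k}} = 1`, `gcd(n,q)=1`, and `C_P` the
`λ`-constacyclic code of length `n` over `F_q` with defining set `P ⊆ 1 + rZ_{rn}`,
`C_P` is Galois LCD (w.r.t. the `k`-Galois inner product) iff `-p^k·P = P` modulo `rn`. -/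
theorem stmt10 {p e k r n : ℕ} (hp : p.Prime) (hk : k < e) (hr : 0 < r) (hn : 0 < n)
    {F : Type*} [Field F] [Fintype F] (hcard : Fintype.card F = p ^ e)
    (hcop : Nat.Coprime n (p ^ e)) (lam : F) (hlam : lam ≠ 0)
    (hord : orderOf lam = r) (hlam1 : lam ^ (1 + p ^ (e - k)) = 1)
    {E : Type*} [Field E] [Algebra F E] (θ : E)
    (hθ : orderOf θ = r * n) (hθn : θ ^ n = algebraMap F E lam)
    (P : Set (ZMod (r * n))) (hP : P ⊆ oneCoset r n)
    (hPq : (fun x : ZMod (r * n) => (p : ZMod (r * n)) ^ e * x) '' P = P) :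
    (codeOfDefSet F n θ P ∩ galoisDualSet (p ^ k) (codeOfDefSet F n θ P) = {0}) ↔
      (fun x : ZMod (r * n) => -(p : ZMod (r * n)) ^ k * x) '' P = P := by
  classical
  have : Fact p.Prime := ⟨hp⟩
  have : NeZero (r * n) := ⟨(Nat.mul_pos hr hn).ne'⟩
  have he : e ≠ 0 := by omega
  have hcharF : CharP F p := by
    rw [CharP.charP_iff_prime_eq_zero hp]
    have h : ((p ^ e : ℕ) : F) = 0 := by rw [← hcard, Nat.cast_card_eq_zero]
    rw [Nat.cast_pow] at h
    exact (pow_eq_zero_iff he).1 h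
  have : CharP E p := charP_of_injective_algebraMap (algebraMap F E).injective p
  have hrq : (p : ZMod r) ^ e = 1 := by
    have h := orderOf_dvd_of_pow_eq_one (FiniteField.pow_card_sub_one_eq_one lam hlam)
    rwa [hord, hcard, ← ZMod.natCast_eq_zero_iff, Nat.cast_sub (Nat.one_le_pow _ _ hp.pos),
      Nat.cast_pow, Nat.cast_one, sub_eq_zero] at h
  have hrk : -(p : ZMod r) ^ k = 1 := by
    have h := orderOf_dvd_of_pow_eq_one hlam1
    rw [hord, ← ZMod.natCast_eq_zero_iff] at h
    push_cast at h
    have h' : (p : ZMod r) ^ k * (1 + (p : ZMod r) ^ (e - k)) = 0 := by rw [h, mul_zero]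
    rw [mul_add, ← pow_add, Nat.add_sub_cancel' hk.le, hrq, mul_one] at h'
    exact neg_eq_of_add_eq_zero_right h'
  have hnp : n.Coprime p := (Nat.coprime_pow_right_iff (Nat.pos_of_ne_zero he) _ _).1 hcop
  have hpunit : IsUnit (p : ZMod (r * n)) := by
    rw [ZMod.isUnit_iff_coprime]
    refine Nat.Coprime.mul_right ?_ hnp.symm
    rw [← ZMod.isUnit_iff_coprime]
    exact (isUnit_pow_iff he).1 (hrq ▸ isUnit_one)
  have hu := (hpunit.pow k).neg
  have hnE : (n : E) ≠ 0 := fun h => by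
    rw [CharP.cast_eq_zero_iff E p] at h
    exact hp.one_lt.ne' (Nat.Coprime.eq_one_of_dvd hnp.symm h)
  set π := ZMod.castHom (dvd_mul_right r n) (ZMod r)
  have hPπ : ∀ l ∈ P, π l = 1 := fun l hl => by
    obtain ⟨t, -, rfl⟩ := hP hl
    simp
  have hπq : ∀ x, π ((p : ZMod (r * n)) ^ e * x) = π x := fun x => by
    rw [map_mul, map_pow, map_natCast, hrq, one_mul]
  have hπu : ∀ x, π (-(p : ZMod (r * n)) ^ k * x) = π x := fun x => by
    rw [map_mul, map_neg, map_pow, map_natCast, hrk, one_mul]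
  have hPq' : ∀ x, (p : ZMod (r * n)) ^ e * x ∈ P ↔ x ∈ P := fun x => by
    conv_lhs => rw [← hPq]
    exact Function.Injective.mem_set_image (f := fun x => (p : ZMod (r * n)) ^ e * x)
      (fun x y hxy => (hpunit.pow e).mul_left_cancel hxy)
  have hθN : θ ^ (r * n) = 1 := hθ ▸ pow_orderOf_eq_one θ
  set ψ := AddChar.zmodChar (r * n) hθN
  have hψθ : ∀ x, ψ x = θ ^ x.val := AddChar.zmodChar_apply hθN
  have hψ : Function.Injective ψ := fun x y hxy => by
    rw [hψθ, hψθ] at hxy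
    exact ZMod.val_injective _
      ((hθ ▸ IsPrimitiveRoot.orderOf θ).pow_inj x.val_lt y.val_lt hxy)
  have hψinv : Function.Injective (ψ⁻¹ : AddChar (ZMod (r * n)) E) := fun x y hxy => by
    rw [AddChar.inv_apply, AddChar.inv_apply] at hxy
    exact neg_injective (hψ hxy)
  have hψpow : ∀ x, ψ x ^ p ^ k = ψ ((p : ZMod (r * n)) ^ k * x) := fun x => by
    rw [← AddChar.map_nsmul_eq_pow, nsmul_eq_mul, Nat.cast_pow]
  rw [Set.image_eq_self_iff_preimage_subset fun x y hxy => hu.mul_left_cancel hxy]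
  constructor
  · intro hLCD l₀ hul₀
    by_contra hl₀
    set Q : Finset (ZMod (r * n)) :=
      Finset.univ.filter fun l => l ∉ P ∧ -(p : ZMod (r * n)) ^ k * l ∈ P with hQ
    have hQπ : ∀ j ∈ Q, π j = 1 := fun j hj => by
      rw [← hπu, hPπ _ (Finset.mem_filter.1 hj).2.2]
    have hQq : ∀ x, (p : ZMod (r * n)) ^ e * x ∈ Q ↔ x ∈ Q := fun x => by
      simp only [hQ, Finset.mem_filter, Finset.mem_univ, true_and, hPq']
      rw [mul_left_comm, hPq']
    choose c hc using exists_algebraMap_eq_sum_addChar (F := F) hcard ψ (hpunit.pow e) Q hQq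
    set x : Fin n → F := fun i => c (0 - (i : ℕ)) with hx
    have hxsum : ∀ l, π l = 1 → ∑ i : Fin n, algebraMap F E (x i) * ψ (l * (i : ℕ)) =
        if l ∈ Q then (n : E) else 0 := fun l hl => by
      simp_rw [hx, hc]
      rw [sum_sum_addChar_mul hψ Q hQπ 0 hl, mul_zero, AddChar.map_zero_eq_one, mul_one]
    have hx0 : x = 0 := by
      rw [← Set.mem_singleton_iff, ← hLCD]
      refine ⟨(mem_codeOfDefSet_iff hψθ).2 fun l hl => ?_, fun d hd => ?_⟩
      · rw [hxsum l (hPπ l hl), if_neg fun h => (Finset.mem_filter.1 h).2.1 hl]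
      · rw [mem_codeOfDefSet_iff hψθ] at hd
        apply (algebraMap F E).injective
        simp_rw [map_sum, map_mul, map_pow, map_zero, hx, hc, sum_pow_char_pow, Finset.mul_sum]
        rw [Finset.sum_comm]
        refine Finset.sum_eq_zero fun j hj => ?_
        rw [← hd _ (Finset.mem_filter.1 hj).2.2]
        refine Finset.sum_congr rfl fun i _ => ?_
        rw [hψpow]
        congr 2
        ring
    have h := hxsum l₀ (by rw [← hπu, hPπ _ hul₀])
    rw [if_pos (by simp [hQ, hl₀, -neg_mul, hul₀])] at h
    exact hnE (by simpa [hx0] using h.symm)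
  · intro hsub
    refine Set.Subset.antisymm (fun x hx => ?_) ?_
    · obtain ⟨hxC, hxD⟩ := hx
      rw [mem_codeOfDefSet_iff hψθ] at hxC
      set S : Finset (ZMod (r * n)) := Finset.univ.filter fun l => π l = 1 ∧ l ∉ P with hS
      have hSπ : ∀ j ∈ S, π j = 1 := fun j hj => (Finset.mem_filter.1 hj).2.1
      have hSq : ∀ x, (p : ZMod (r * n)) ^ e * x ∈ S ↔ x ∈ S := fun x => by
        simp only [hS, Finset.mem_filter, Finset.mem_univ, true_and, hPq', hπq]
      choose c hc using exists_algebraMap_eq_sum_addChar (F := F) hcard ψ (hpunit.pow e) S hSq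
      have hcC : ∀ a : ZMod (r * n), (fun i : Fin n => c (a - (i : ℕ))) ∈ codeOfDefSet F n θ P :=
        fun a => (mem_codeOfDefSet_iff hψθ).2 fun l hl => by
          simp_rw [hc]
          rw [sum_sum_addChar_mul hψ S hSπ a (hPπ l hl),
            if_neg fun h => (Finset.mem_filter.1 h).2.2 hl]
      have hdual : ∀ j ∈ S, ∑ i : Fin n, ψ (-(j * (i : ℕ))) * algebraMap F E (x i) ^ p ^ k = 0 :=
        fun j hj => by
          have hsum : ∀ i : Fin n, (n : E) * ψ (-(j * (i : ℕ))) =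
              ∑ a : Fin n, algebraMap F E (c ((a : ℕ) - (i : ℕ))) * ψ (-(j * (a : ℕ))) := fun i => by
            have h := sum_sum_addChar_mul hψinv S hSπ (i : ℕ) (hSπ j hj)
            rw [if_pos hj] at h
            simp only [AddChar.inv_apply, ← mul_neg, neg_sub] at h
            simp_rw [hc, ← mul_neg]
            exact h.symm
          refine (mul_eq_zero.1 (?_ : (n : E) * _ = 0)).resolve_left hnE
          simp_rw [Finset.mul_sum, ← mul_assoc, hsum, Finset.sum_mul]
          rw [Finset.sum_comm]
          refine Finset.sum_eq_zero fun a _ => ?_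
          have h := congrArg (algebraMap F E) (hxD _ (hcC (a : ℕ)))
          rw [map_zero, map_sum] at h
          rw [← mul_zero (ψ (-(j * (a : ℕ)))), ← h, Finset.mul_sum]
          refine Finset.sum_congr rfl fun i _ => ?_
          rw [map_mul, map_pow]
          ring
      have hx0 := eq_zero_of_forall_sum_addChar_eq_zero hψ (x := fun i => algebraMap F E (x i))
        fun l hl => by
          by_cases hlP : l ∈ P
          · exact hxC l hlP
          · have h := hdual (-(p : ZMod (r * n)) ^ k * l) (by
              simp only [hS, Finset.mem_filter, Finset.mem_univ, true_and, hπu]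
              exact ⟨hl, fun h => hlP (hsub l h)⟩)
            refine pow_eq_zero_iff (pow_ne_zero k hp.ne_zero) |>.1 ?_
            rw [sum_pow_char_pow, ← h]
            refine Finset.sum_congr rfl fun i _ => ?_
            rw [mul_pow, hψpow, mul_comm, neg_mul, neg_mul, neg_neg, mul_assoc]
      funext i
      exact (algebraMap F E).injective ((congrFun hx0 i).trans (map_zero _).symm)
    · rintro _ rfl
      refine ⟨(mem_codeOfDefSet_iff hψθ).2 fun l _ => by simp, fun c _ => ?_⟩
      simp [hp.ne_zero]
end

section
/- Let q = p^e (p prime), 0 ≤ k < e, let r and n be positive integers with n coprime to q and r dividing q−1, and let Q_s ⊆ 1 + rZ_{rn} be a q-cyclotomic coset modulo rn. Then −p^k·Q_s = Q_s (modulo rn) if and only if there exists an integer j such that s(1 + p^{ej−k}) ≡ 0 (mod rn). -/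
/-- The `q`-cyclotomic coset of `s` modulo `N`: `{s, qs, q²s, …}` in `Z_N`. -/
def cycCoset (q : ℕ) {N : ℕ} (s : ZMod N) : Set (ZMod N) :=
  {x | ∃ m : ℕ, x = (q : ZMod N) ^ m * s}

theorem isUnit_natCast_zmod_mul {p e r n : ℕ} (hp : p.Prime) (he : e ≠ 0)
    (hcop : Nat.Coprime n (p ^ e)) (hrq : r ∣ p ^ e - 1) :
    IsUnit (p : ZMod (r * n)) := by
  have hpn : Nat.Coprime p n :=
    ((Nat.coprime_pow_right_iff (Nat.pos_of_ne_zero he) n p).1 hcop).symm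
  have hpr : Nat.Coprime p r := by
    refine (Nat.Prime.coprime_iff_not_dvd hp).2 fun h => hp.one_lt.ne' ?_
    have h1 : p ∣ p ^ e - (p ^ e - 1) :=
      Nat.dvd_sub (dvd_pow_self p he) (h.trans hrq)
    rw [Nat.sub_sub_self (Nat.one_le_pow _ _ hp.pos)] at h1
    exact Nat.dvd_one.1 h1
  exact (ZMod.isUnit_iff_coprime p (r * n)).2 (hpr.mul_right hpn)

theorem exists_pow_succ_eq_one_of_isUnit {M : Type*} [Monoid M] [Finite M] {a : M}
    (ha : IsUnit a) : ∃ d : ℕ, a ^ (d + 1) = 1 := by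
  obtain ⟨u, rfl⟩ := ha
  obtain ⟨d, hd, h⟩ := isOfFinOrder_iff_pow_eq_one.1 (isOfFinOrder_of_finite u)
  refine ⟨d - 1, ?_⟩
  rw [Nat.sub_add_cancel hd, ← Units.val_pow_eq_pow_val, h, Units.val_one]

theorem image_mul_cycCoset_eq_iff {q N : ℕ} [NeZero N] (hq : IsUnit (q : ZMod N))
    (a s : ZMod N) :
    (fun x => a * x) '' cycCoset q s = cycCoset q s ↔ ∃ m : ℕ, a * s = (q : ZMod N) ^ m * s := by
  constructor
  · intro h
    have : a * s ∈ cycCoset q s := h ▸ ⟨s, ⟨0, by simp⟩, rfl⟩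
    exact this
  · rintro ⟨j, hj⟩
    obtain ⟨d, hd⟩ := exists_pow_succ_eq_one_of_isUnit hq
    ext x
    constructor
    · rintro ⟨_, ⟨m, rfl⟩, rfl⟩
      exact ⟨m + j, by linear_combination (q : ZMod N) ^ m * hj⟩
    · rintro ⟨m, rfl⟩
      refine ⟨_, ⟨m + j * d, rfl⟩, ?_⟩
      have hperiod : (q : ZMod N) ^ (j * (d + 1)) = 1 := by
        rw [mul_comm, pow_mul, hd, one_pow]
      linear_combination (q : ZMod N) ^ (m + j * d) * hj + (q : ZMod N) ^ m * s * hperiod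

/-- For `q = p^e`, `0 ≤ k < e`, `gcd(n,q) = 1`, `r ∣ q - 1`, and a
`q`-cyclotomic coset `Q_s ⊆ 1 + rZ_{rn}` modulo `rn`: `-p^k·Q_s = Q_s` iff there is an
integer `j` with `s(1 + p^{ej-k}) ≡ 0 (mod rn)`. -/
theorem stmt12 {p e k r n : ℕ} (hp : p.Prime) (hk : k < e) (hr : 0 < r) (hn : 0 < n)
    (hcop : Nat.Coprime n (p ^ e)) (hrq : r ∣ p ^ e - 1)
    (s : ZMod (r * n)) (hQ : cycCoset (p ^ e) s ⊆ oneCoset r n) :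
    ((fun x : ZMod (r * n) => -(p : ZMod (r * n)) ^ k * x) '' cycCoset (p ^ e) s
        = cycCoset (p ^ e) s) ↔
      ∃ j : ℕ, k ≤ e * j ∧ s * (1 + (p : ZMod (r * n)) ^ (e * j - k)) = 0 := by
  have hp_unit : IsUnit (p : ZMod (r * n)) :=
    isUnit_natCast_zmod_mul hp (by omega) hcop hrq
  have hq_unit : IsUnit ((p ^ e : ℕ) : ZMod (r * n)) := by
    rw [Nat.cast_pow]
    exact hp_unit.pow e
  have : NeZero (r * n) := ⟨(Nat.mul_pos hr hn).ne'⟩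
  have key : ∀ j : ℕ, k ≤ e * j →
      (s * (1 + (p : ZMod (r * n)) ^ (e * j - k)) = 0 ↔
        -(p : ZMod (r * n)) ^ k * s = ((p ^ e : ℕ) : ZMod (r * n)) ^ j * s) := by
    intro j hj
    have hpow : (p : ZMod (r * n)) ^ k * (p : ZMod (r * n)) ^ (e * j - k)
        = ((p ^ e : ℕ) : ZMod (r * n)) ^ j := by
      rw [← pow_add, Nat.add_sub_cancel' hj, Nat.cast_pow, pow_mul]
    rw [← (hp_unit.pow k).mul_right_eq_zero, ← hpow]
    constructor <;> intro h <;> linear_combination -h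
  rw [image_mul_cycCoset_eq_iff hq_unit]
  constructor
  · rintro ⟨m, hm⟩
    obtain ⟨d, hd⟩ := exists_pow_succ_eq_one_of_isUnit hq_unit
    have hle : k ≤ e * (m + (d + 1)) :=
      hk.le.trans (Nat.le_mul_of_pos_right e (by omega))
    refine ⟨m + (d + 1), hle, (key _ hle).2 ?_⟩
    rw [pow_add, hd, mul_one, hm]
  · rintro ⟨j, hj, h⟩
    exact ⟨j, (key j hj).1 h⟩
end

section
/- Let q = p^e (p prime), 0 ≤ k < e, let r and n be positive integers with n coprime to q and r dividing q−1, and let Q_s ⊆ 1 + rZ_{rn} be a q-cyclotomic coset modulo rn with −p^k·Q_s ≠ Q_s. Set P = Q_s ∪ (−p^k·Q_s). Then −p^k·P = P (modulo rn) if and only if there exists an integer j such that p^{2k}·s ≡ q^j·s (mod rn). -/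
theorem image_mul_cycCoset (q : ℕ) {N : ℕ} (u s : ZMod N) :
    (fun x => u * x) '' cycCoset q s = cycCoset q (u * s) := by
  ext x
  constructor
  · rintro ⟨_, ⟨m, rfl⟩, rfl⟩
    exact ⟨m, mul_left_comm _ _ _⟩
  · rintro ⟨m, rfl⟩
    exact ⟨_, ⟨m, rfl⟩, mul_left_comm _ _ _⟩

theorem mem_cycCoset_self (q : ℕ) {N : ℕ} (s : ZMod N) : s ∈ cycCoset q s :=
  ⟨0, by simp⟩

theorem cycCoset_eq_of_mem {q N : ℕ} (hN : 0 < N) (hq : q.Coprime N) {s x : ZMod N}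
    (hx : x ∈ cycCoset q s) : cycCoset q x = cycCoset q s := by
  obtain ⟨m, rfl⟩ := hx
  have hpow : (q : ZMod N) ^ N.totient = 1 := by
    have h := congrArg Units.val (ZMod.pow_totient (ZMod.unitOfCoprime q hq))
    rwa [Units.val_pow_eq_pow_val, ZMod.coe_unitOfCoprime, Units.val_one] at h
  obtain ⟨t, ht⟩ : ∃ t, N.totient = t + 1 :=
    Nat.exists_eq_succ_of_ne_zero (Nat.totient_pos.2 hN).ne'
  ext y
  constructor
  · rintro ⟨a, rfl⟩
    exact ⟨a + m, by ring⟩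
  · rintro ⟨a, rfl⟩
    refine ⟨a + m * t, ?_⟩
    calc (q : ZMod N) ^ a * s = (q : ZMod N) ^ a * (q ^ N.totient) ^ m * s := by
          rw [hpow, one_pow, mul_one]
      _ = (q : ZMod N) ^ (a + m * t) * (q ^ m * s) := by rw [ht]; ring

/-- For `q = p^e`, `0 ≤ k < e`, `gcd(n,q) = 1`, `r ∣ q - 1`, and a
`q`-cyclotomic coset `Q_s ⊆ 1 + rZ_{rn}` with `-p^k·Q_s ≠ Q_s`, set `P = Q_s ∪ (-p^k·Q_s)`.
Then `-p^k·P = P` iff there is an integer `j` with `p^{2k}·s ≡ q^j·s (mod rn)`. -/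
theorem stmt13 {p e k r n : ℕ} (hp : p.Prime) (hk : k < e) (hr : 0 < r) (hn : 0 < n)
    (hcop : Nat.Coprime n (p ^ e)) (hrq : r ∣ p ^ e - 1)
    (s : ZMod (r * n)) (hQ : cycCoset (p ^ e) s ⊆ oneCoset r n)
    (hne : (fun x : ZMod (r * n) => -(p : ZMod (r * n)) ^ k * x) '' cycCoset (p ^ e) s
      ≠ cycCoset (p ^ e) s) :
    ((fun x : ZMod (r * n) => -(p : ZMod (r * n)) ^ k * x) ''
        (cycCoset (p ^ e) s ∪
          (fun x : ZMod (r * n) => -(p : ZMod (r * n)) ^ k * x) '' cycCoset (p ^ e) s)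
      = cycCoset (p ^ e) s ∪
          (fun x : ZMod (r * n) => -(p : ZMod (r * n)) ^ k * x) '' cycCoset (p ^ e) s) ↔
      ∃ j : ℕ, (p : ZMod (r * n)) ^ (2 * k) * s = ((p : ZMod (r * n)) ^ e) ^ j * s := by
  have hN : 0 < r * n := Nat.mul_pos hr hn
  have he : 0 < e := hk.pos
  have hpr : p.Coprime r := by
    refine (Nat.Prime.coprime_iff_not_dvd hp).2 fun h => hp.one_lt.ne' ?_
    have h1 : p ∣ p ^ e - 1 := h.trans hrq
    have h2 : p ∣ p ^ e := dvd_pow_self p he.ne'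
    have h3 : 1 ≤ p ^ e := Nat.pow_pos hp.pos
    exact Nat.dvd_one.1 ((Nat.dvd_sub_iff_right h3 h2).1 h1)
  have hpn : p.Coprime n := (Nat.coprime_pow_right_iff he n p).1 hcop |>.symm
  have hpN : p.Coprime (r * n) := hpr.mul_right hpn
  have hqN : (p ^ e).Coprime (r * n) := hpN.pow_left e
  have hu : IsUnit (-(p : ZMod (r * n)) ^ k) :=
    (((ZMod.isUnit_iff_coprime p (r * n)).2 hpN).pow k).neg
  have hu2 : (p : ZMod (r * n)) ^ (2 * k) * s
      = -(p : ZMod (r * n)) ^ k * (-(p : ZMod (r * n)) ^ k * s) := by ring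
  rw [hu2]
  generalize -(p : ZMod (r * n)) ^ k = u at *
  simp only [Set.image_union, image_mul_cycCoset] at hne ⊢
  constructor
  · intro h
    have hmem : u * (u * s) ∈ cycCoset (p ^ e) s ∪ cycCoset (p ^ e) (u * s) :=
      h ▸ Or.inr (mem_cycCoset_self _ _)
    rcases hmem with ⟨j, hj⟩ | ⟨m, hm⟩
    · exact ⟨j, by simpa using hj⟩
    · rw [mul_left_comm (_ ^ m) u s] at hm
      exact absurd (cycCoset_eq_of_mem hN hqN ⟨m, hu.mul_left_cancel hm⟩) hne
  · rintro ⟨j, hj⟩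
    rw [cycCoset_eq_of_mem hN hqN (s := s) (x := u * (u * s)) ⟨j, by simpa using hj⟩,
      Set.union_comm]
end

section
/- Let q = p^e (p prime), 0 ≤ k < e, λ ∈ F_q^* with order r and λ^{1+p^{e-k}} = 1, and n coprime to q. Then every λ-constacyclic code C_P of length n over F_q (for every defining set P ⊆ 1 + rZ_{rn} that is a union of q-cyclotomic cosets) is a Galois LCD code with respect to the k-Galois inner product if and only if Q_1 = Q_{−p^k}, where Q_1 = {1, q, q², …, q^{m_1−1}} is the q-cyclotomic coset of 1 modulo rn (m_1 being the smallest positive integer with q^{m_1} ≡ 1 mod rn) and Q_{−p^k} is the q-cyclotomic coset of −p^k modulo rn. -/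
open Finset Polynomial

/-- The value at `z` of the polynomial with coefficient vector `c`. -/
noncomputable def evalVec {F E : Type*} [Field F] [Field E] [Algebra F E] {n : ℕ}
    (c : Fin n → F) (z : E) : E :=
  ∑ j : Fin n, algebraMap F E (c j) * z ^ (j : ℕ)

theorem aeval_sum_C_mul_X_pow {F E : Type*} [Field F] [Field E] [Algebra F E] {n : ℕ}
    (c : Fin n → F) (z : E) :
    aeval z (∑ j : Fin n, C (c j) * X ^ (j : ℕ)) = evalVec c z := by
  simp [evalVec]

theorem mem_codeOfDefSet {F E : Type*} [Field F] [Field E] [Algebra F E] {n N : ℕ} {θ : E}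
    {P : Set (ZMod N)} {c : Fin n → F} :
    c ∈ codeOfDefSet F n θ P ↔ ∀ i ∈ P, evalVec c (θ ^ i.val) = 0 := by
  simp only [codeOfDefSet, Set.mem_ofPred_eq, aeval_sum_C_mul_X_pow]

theorem evalVec_pow_char_pow {F E : Type*} [Field F] [Field E] [Algebra F E] {n p : ℕ}
    [Fact p.Prime] [CharP E p] (c : Fin n → F) (z : E) (k : ℕ) :
    evalVec c z ^ p ^ k = evalVec (fun j => c j ^ p ^ k) (z ^ p ^ k) := by
  simp only [evalVec, sum_pow_char_pow, mul_pow, map_pow]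
  refine Finset.sum_congr rfl fun j _ => ?_
  rw [← pow_mul, ← pow_mul, mul_comm (p ^ k)]

theorem evalVec_pow_card_pow {F E : Type*} [Field F] [Fintype F] [Field E] [Algebra F E]
    {n p e : ℕ} [Fact p.Prime] [CharP E p] (hcard : Fintype.card F = p ^ e)
    (c : Fin n → F) (z : E) (m : ℕ) :
    evalVec c (z ^ (p ^ e) ^ m) = evalVec c z ^ (p ^ e) ^ m := by
  have h : ∀ a : F, a ^ (p ^ e) ^ m = a := fun a => by
    rw [← hcard, FiniteField.pow_card_pow]
  rw [← pow_mul] at h ⊢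
  rw [evalVec_pow_char_pow]
  simp only [h]

/-- A vector whose polynomial of degree `< n` vanishes at `n` distinct points is zero. -/
theorem eq_zero_of_evalVec_eq_zero {F E : Type*} [Field F] [Field E] [Algebra F E] {n : ℕ}
    (c : Fin n → F) (z : Fin n → E) (hz : Function.Injective z)
    (h : ∀ i, evalVec c (z i) = 0) : c = 0 := by
  have h1 : (fun j => algebraMap F E (c j)) = 0 := by
    refine Matrix.eq_zero_of_forall_index_sum_mul_pow_eq_zero hz fun i => ?_
    exact h i
  funext j
  simpa using congrFun h1 j

/-- The extension of a vector to a sequence with `x (m + n) = μ * x m`. -/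
def constaExt {F : Type*} [Field F] {n : ℕ} [NeZero n] (μ : F) (x : Fin n → F) (m : ℕ) : F :=
  μ ^ (m / n) * x (Fin.ofNat n m)

theorem constaExt_val {F : Type*} [Field F] {n : ℕ} [NeZero n] (μ : F) (x : Fin n → F)
    (j : Fin n) : constaExt μ x j = x j := by
  simp [constaExt, Nat.div_eq_of_lt j.isLt]

theorem constaExt_add {F : Type*} [Field F] {n : ℕ} [NeZero n] (μ : F) (x : Fin n → F)
    (m : ℕ) : constaExt μ x (m + n) = μ * constaExt μ x m := by
  have : Fin.ofNat n (m + n) = Fin.ofNat n m := by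
    ext; simp
  rw [constaExt, constaExt, this, Nat.add_div_right _ (NeZero.pos n)]
  ring

theorem sum_range_add_of_periodic {M : Type*} [AddCommGroup M] {n : ℕ} {f : ℕ → M}
    (hf : Function.Periodic f n) (a : ℕ) :
    ∑ l ∈ range n, f (l + a) = ∑ l ∈ range n, f l := by
  induction a with
  | zero => rfl
  | succ a ih =>
    rw [← ih]
    have h1 := Finset.sum_range_succ (fun l => f (l + a)) n
    rw [Finset.sum_range_succ'] at h1
    rw [zero_add, add_comm n a, hf a] at h1
    have h2 := add_right_cancel h1
    rw [← h2]
    exact Finset.sum_congr rfl fun l _ => by congr 1; ring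

theorem sum_constaExt {F E : Type*} [Field F] [Field E] [Algebra F E] {n : ℕ} [NeZero n]
    {lam : F} (hlam : lam ≠ 0) (x : Fin n → F) {z : E} (hz : z ^ n = algebraMap F E lam)
    (a : ℕ) :
    ∑ l : Fin n, algebraMap F E (constaExt lam⁻¹ x (l + a)) * z ^ ((l : ℕ) + a) =
      evalVec x z := by
  have hper : Function.Periodic
      (fun m => algebraMap F E (constaExt lam⁻¹ x m) * z ^ m) n := by
    intro m
    have h0 : algebraMap F E lam ≠ 0 := by simpa using hlam
    simp only [constaExt_add, pow_add, hz, map_mul, map_inv₀]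
    field_simp
  have h := sum_range_add_of_periodic hper a
  rw [Finset.sum_range, Finset.sum_range] at h
  rw [h, evalVec]
  simp only [constaExt_val]

/-- If `x` is orthogonal to all constacyclic shifts of `y`, then the product of their
transforms vanishes. -/
theorem evalVec_mul_evalVec_eq_zero {F E : Type*} [Field F] [Field E] [Algebra F E] {n : ℕ}
    [NeZero n] {lam : F} (hlam : lam ≠ 0) (x y : Fin n → F) {z w : E}
    (hz : z ^ n = algebraMap F E lam) (hzw : z * w = 1)
    (h : ∀ a : ℕ, ∑ l : Fin n, constaExt lam⁻¹ y (l + a) * x l = 0) :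
    evalVec y z * evalVec x w = 0 := by
  calc evalVec y z * evalVec x w
      = ∑ l : Fin n, ∑ a : Fin n, z ^ (a : ℕ) *
          algebraMap F E (constaExt lam⁻¹ y (l + a) * x l) := by
        rw [evalVec.eq_1 x, Finset.mul_sum]
        refine Finset.sum_congr rfl fun l _ => ?_
        rw [← sum_constaExt hlam y hz l, Finset.sum_mul]
        refine Finset.sum_congr rfl fun a _ => ?_
        have h1 : z ^ (l : ℕ) * w ^ (l : ℕ) = 1 := by rw [← mul_pow, hzw, one_pow]
        rw [map_mul, pow_add, add_comm (l : ℕ) a]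
        linear_combination (algebraMap F E (constaExt lam⁻¹ y (a + l)) * z ^ (a : ℕ) *
          algebraMap F E (x l)) * h1
    _ = 0 := by
        rw [Finset.sum_comm]
        refine Finset.sum_eq_zero fun a _ => ?_
        rw [← Finset.mul_sum, ← map_sum, h, map_zero, mul_zero]

theorem evalVec_shift_eq_zero {F E : Type*} [Field F] [Field E] [Algebra F E] {n : ℕ}
    [NeZero n] {lam : F} (hlam : lam ≠ 0) (x : Fin n → F) {z : E}
    (hz : z ^ n = algebraMap F E lam) (hx : evalVec x z = 0) (a : ℕ) :
    evalVec (fun l : Fin n => constaExt lam⁻¹ x (l + a)) z = 0 := by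
  have hz0 : z ≠ 0 := by
    rintro rfl
    rw [zero_pow (NeZero.ne n)] at hz
    exact hlam (by simpa using hz.symm)
  have h := sum_constaExt hlam x hz a
  rw [hx] at h
  have h2 : evalVec (fun l : Fin n => constaExt lam⁻¹ x (l + a)) z * z ^ a = 0 := by
    rw [← h, evalVec, Finset.sum_mul]
    exact Finset.sum_congr rfl fun l _ => by ring
  exact (mul_eq_zero.mp h2).resolve_right (pow_ne_zero _ hz0)

theorem mem_oneCoset_iff {F E : Type*} [Field F] [Field E] [Algebra F E] {r n : ℕ}
    (hr : 0 < r) (hn : 0 < n) {lam : F} {θ : E} (hθ : orderOf θ = r * n)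
    (hθn : θ ^ n = algebraMap F E lam) (x : ZMod (r * n)) :
    x ∈ oneCoset r n ↔ (θ ^ x.val) ^ n = algebraMap F E lam := by
  have : NeZero (r * n) := ⟨(Nat.mul_pos hr hn).ne'⟩
  have hrn : (r : ZMod (r * n)) * n = 0 := by
    rw [← Nat.cast_mul, ZMod.natCast_self]
  have key : (θ ^ x.val) ^ n = algebraMap F E lam ↔ (n : ZMod (r * n)) * x = n := by
    have hfin : IsOfFinOrder θ := orderOf_pos_iff.mp (hθ ▸ Nat.mul_pos hr hn)
    rw [← hθn, ← pow_mul, hfin.pow_eq_pow_iff_modEq, hθ, ← ZMod.natCast_eq_natCast_iff]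
    push_cast
    rw [ZMod.natCast_zmod_val, mul_comm x]
  rw [key]
  constructor
  · rintro ⟨t, -, rfl⟩
    linear_combination (t : ZMod (r * n)) * hrn
  · intro h
    have h1 : ((((n : ℤ) * ((x.val : ℤ) - 1) : ℤ)) : ZMod (r * n)) = 0 := by
      push_cast
      rw [ZMod.natCast_zmod_val]
      linear_combination h
    rw [ZMod.intCast_zmod_eq_zero_iff_dvd] at h1
    push_cast at h1
    rw [mul_comm (r : ℤ)] at h1
    obtain ⟨s, hs⟩ := Int.dvd_of_mul_dvd_mul_left (by exact_mod_cast hn.ne') h1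
    have hn' : (n : ℤ) ≠ 0 := by exact_mod_cast hn.ne'
    have ht : ((s % n).toNat : ℤ) = s % n := Int.toNat_of_nonneg (Int.emod_nonneg _ hn')
    refine ⟨(s % n).toNat, ?_, ?_⟩
    · have := Int.emod_lt_of_pos s (by exact_mod_cast hn : (0 : ℤ) < n)
      omega
    · have hx : x = 1 + (r : ZMod (r * n)) * (s : ZMod (r * n)) := by
        have := congrArg (Int.cast : ℤ → ZMod (r * n)) hs
        push_cast at this
        rw [ZMod.natCast_zmod_val] at this
        linear_combination this
      have h3 := congrArg (Int.cast : ℤ → ZMod (r * n)) (Int.emod_add_mul_ediv s n)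
      have h4 := congrArg (Int.cast : ℤ → ZMod (r * n)) ht
      push_cast at h3 h4
      rw [hx, ← h3, h4]
      linear_combination ((s / (n : ℤ) : ℤ) : ZMod (r * n)) * hrn

/-- In an extension of a field with `q` elements, the elements fixed by `x ↦ x ^ q` are the
elements of the base field. -/
theorem exists_algebraMap_eq_of_pow_card_eq {F E : Type*} [Field F] [Fintype F] [Field E]
    [Algebra F E] {x : E} (hx : x ^ Fintype.card F = x) : ∃ a : F, algebraMap F E a = x := by
  classical
  have h0 : (X ^ Fintype.card F - X : E[X]) ≠ 0 :=
    FiniteField.X_pow_card_sub_X_ne_zero E Fintype.one_lt_card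
  have hsub : Finset.univ.map ⟨algebraMap F E, (algebraMap F E).injective⟩ ⊆
      (X ^ Fintype.card F - X : E[X]).roots.toFinset := by
    intro y hy
    obtain ⟨a, -, rfl⟩ := Finset.mem_map.mp hy
    simp [h0, ← map_pow, FiniteField.pow_card]
  have heq := Finset.eq_of_subset_of_card_le hsub (by
    refine (Multiset.toFinset_card_le _).trans ((card_roots' _).trans ?_)
    rw [FiniteField.X_pow_card_sub_X_natDegree_eq E Fintype.one_lt_card, Finset.card_map,
      Finset.card_univ])
  have hx' : x ∈ (X ^ Fintype.card F - X : E[X]).roots.toFinset := by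
    simp [h0, hx]
  rw [← heq] at hx'
  obtain ⟨a, -, ha⟩ := Finset.mem_map.mp hx'
  exact ⟨a, ha⟩

theorem sum_pow_eq_ite {E : Type*} [Field E] {n : ℕ} {z : E} [Decidable (z = 1)] (hz : z ^ n = 1) :
    ∑ j : Fin n, z ^ (j : ℕ) = if z = 1 then (n : E) else 0 := by
  split_ifs with h
  · simp [h]
  · rw [← Finset.sum_range (fun j => z ^ j), geom_sum_eq h, hz, sub_self, zero_div]

theorem natCast_mul_mem_cycCoset_one_iff {q N d : ℕ} (hqd : (q : ZMod N) ^ (d + 1) = 1)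
    (x : ZMod N) : q * x ∈ cycCoset q (1 : ZMod N) ↔ x ∈ cycCoset q (1 : ZMod N) := by
  constructor
  · rintro ⟨m, hm⟩
    refine ⟨d + m, ?_⟩
    rw [pow_add, mul_assoc, ← hm, ← mul_assoc, ← pow_succ, hqd, one_mul]
  · rintro ⟨m, rfl⟩
    exact ⟨m + 1, by ring⟩

theorem pow_mul_mem_cycCoset_one_iff {q N d : ℕ} (hqd : (q : ZMod N) ^ (d + 1) = 1)
    (m : ℕ) (x : ZMod N) :
    q ^ m * x ∈ cycCoset q (1 : ZMod N) ↔ x ∈ cycCoset q (1 : ZMod N) := by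
  induction m with
  | zero => simp
  | succ m ih => rw [pow_succ', mul_assoc, natCast_mul_mem_cycCoset_one_iff hqd, ih]

theorem cycCoset_one_eq_iff {q N d : ℕ} (hqd : (q : ZMod N) ^ (d + 1) = 1) (s : ZMod N) :
    cycCoset q (1 : ZMod N) = cycCoset q s ↔ s ∈ cycCoset q (1 : ZMod N) := by
  constructor
  · intro h
    rw [h]
    exact ⟨0, by simp⟩
  · rintro ⟨m, rfl⟩
    ext x
    constructor
    · rintro ⟨a, rfl⟩
      refine ⟨a + d * m, ?_⟩
      have h : ((q : ZMod N) ^ (d + 1)) ^ m = 1 := by rw [hqd, one_pow]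
      rw [← pow_mul] at h
      calc (q : ZMod N) ^ a * 1 = q ^ a * q ^ ((d + 1) * m) := by rw [h]
        _ = _ := by ring
    · rintro ⟨a, rfl⟩
      exact ⟨a + m, by ring⟩

/-- With `λ` of order `r`, `λ^{1+p^{e-k}} = 1`, `gcd(n,q)=1`: every
`λ`-constacyclic code `C_P` of length `n` over `F_q` (for every defining set
`P ⊆ 1 + rZ_{rn}` that is a union of `q`-cyclotomic cosets) is Galois LCD iff
`Q_1 = Q_{-p^k}`, the `q`-cyclotomic cosets of `1` and `-p^k` modulo `rn`. -/
theorem stmt14 {p e k r n : ℕ} (hp : p.Prime) (hk : k < e) (hr : 0 < r) (hn : 0 < n)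
    {F : Type*} [Field F] [Fintype F] (hcard : Fintype.card F = p ^ e)
    (hcop : Nat.Coprime n (p ^ e)) (lam : F) (hlam : lam ≠ 0)
    (hord : orderOf lam = r) (hlam1 : lam ^ (1 + p ^ (e - k)) = 1)
    {E : Type*} [Field E] [Algebra F E] (θ : E)
    (hθ : orderOf θ = r * n) (hθn : θ ^ n = algebraMap F E lam) :
    (∀ P : Set (ZMod (r * n)), P ⊆ oneCoset r n →
        (fun x : ZMod (r * n) => (p : ZMod (r * n)) ^ e * x) '' P = P →
        codeOfDefSet F n θ P ∩ galoisDualSet (p ^ k) (codeOfDefSet F n θ P) = {0}) ↔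
      cycCoset (p ^ e) (1 : ZMod (r * n)) = cycCoset (p ^ e) (-(p : ZMod (r * n)) ^ k) := by
  classical
  have : Fact p.Prime := ⟨hp⟩
  have : NeZero n := ⟨hn.ne'⟩
  have : NeZero (r * n) := ⟨(Nat.mul_pos hr hn).ne'⟩
  have : CharP F p := charP_of_card_eq_prime_pow hcard
  have : CharP E p := charP_of_injective_algebraMap (algebraMap F E).injective p
  have hlamq : lam ^ p ^ e = lam := by rw [← hcard, FiniteField.pow_card]
  have hlamk : lam * lam ^ p ^ k = 1 := by
    have h : (lam ^ (1 + p ^ (e - k))) ^ p ^ k = 1 := by rw [hlam1, one_pow]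
    rwa [← pow_mul, add_mul, one_mul, ← pow_add, Nat.sub_add_cancel hk.le, pow_add, hlamq,
      mul_comm] at h
  have hpn : p.Coprime n := (Nat.coprime_pow_right_iff (by omega) _ _).mp hcop |>.symm
  have hpr : p.Coprime r := by
    have hdvd : r ∣ 1 + p ^ (e - k) := hord ▸ orderOf_dvd_of_pow_eq_one hlam1
    refine Nat.Coprime.coprime_dvd_right hdvd ?_
    rw [← Nat.sub_add_cancel (show 1 ≤ e - k by omega), pow_succ]
    simp
  have hq : IsUnit ((p ^ e : ℕ) : ZMod (r * n)) :=
    (ZMod.isUnit_iff_coprime _ _).mpr ((hpr.mul_right hpn).pow_left e)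
  obtain ⟨d, hqd⟩ : ∃ d, ((p ^ e : ℕ) : ZMod (r * n)) ^ (d + 1) = 1 := by
    obtain ⟨v, hv⟩ := hq
    refine ⟨orderOf v - 1, ?_⟩
    rw [Nat.sub_add_cancel (orderOf_pos v), ← hv, ← Units.val_pow_eq_pow_val, pow_orderOf_eq_one,
      Units.val_one]
  obtain ⟨ψ, hψ⟩ : ∃ ψ : AddChar (ZMod (r * n)) E, ∀ x, θ ^ x.val = ψ x :=
    ⟨AddChar.zmodChar (r * n) (hθ ▸ pow_orderOf_eq_one θ), fun x => rfl⟩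
  have hψinj : Function.Injective ψ := by
    intro x y hxy
    rw [← hψ, ← hψ] at hxy
    exact ZMod.val_injective _ (pow_injOn_Iio_orderOf
      (by simpa [hθ] using ZMod.val_lt x) (by simpa [hθ] using ZMod.val_lt y) hxy)
  have hψmul : ∀ (a : ℕ) (x : ZMod (r * n)), ψ (a * x) = ψ x ^ a := fun a x => by
    rw [← nsmul_eq_mul, AddChar.map_nsmul_eq_pow]
  have hψneg : ∀ x, ψ (-x) * ψ x = 1 := fun x => by
    rw [← AddChar.map_add_eq_mul, neg_add_cancel, AddChar.map_zero_eq_one]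
  have hone : ∀ x, x ∈ oneCoset r n ↔ ψ x ^ n = algebraMap F E lam := fun x => by
    rw [mem_oneCoset_iff hr hn hθ hθn, hψ]
  have hone1 : (1 : ZMod (r * n)) ∈ oneCoset r n := ⟨0, hn, by simp⟩
  have honeq : ∀ x, ((p ^ e : ℕ) : ZMod (r * n)) * x ∈ oneCoset r n ↔ x ∈ oneCoset r n := by
    intro x
    rw [hone, hone, hψmul, ← pow_mul, mul_comm (p ^ e), pow_mul]
    nth_rw 1 [← hlamq]
    rw [map_pow]
    exact (iterateFrobenius_inj E p e).eq_iff
  have honek : ∀ x ∈ oneCoset r n, -((p ^ k : ℕ) * x : ZMod (r * n)) ∈ oneCoset r n := by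
    intro x hx
    rw [hone] at hx ⊢
    have h1 := congrArg (· ^ n) (hψneg ((p ^ k : ℕ) * x))
    simp only [mul_pow, one_pow] at h1
    rw [hψmul, ← pow_mul, mul_comm (p ^ k), pow_mul, hx] at h1
    have h2 := congrArg (algebraMap F E) hlamk
    rw [map_mul, map_pow, map_one] at h2
    have h3 : algebraMap F E lam ^ p ^ k ≠ 0 := pow_ne_zero _ (by simpa using hlam)
    exact mul_right_cancel₀ h3 (h1.trans h2.symm)
  have hcode : ∀ (P : Set (ZMod (r * n))) (c : Fin n → F),
      c ∈ codeOfDefSet F n θ P ↔ ∀ i ∈ P, evalVec c (ψ i) = 0 := fun P c => by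
    simp only [mem_codeOfDefSet, hψ]
  have hcast : -(p : ZMod (r * n)) ^ k = -((p ^ k : ℕ) * 1) := by push_cast; ring
  rw [cycCoset_one_eq_iff hqd, hcast]
  constructor
  · intro hLCD
    by_contra hk1
    set Q := cycCoset (p ^ e) (1 : ZMod (r * n)) with hQ
    have hQ1 : (1 : ZMod (r * n)) ∈ Q := ⟨0, by simp⟩
    have hQone : ∀ x ∈ Q, x ∈ oneCoset r n := by
      rintro x ⟨m, rfl⟩
      induction m with
      | zero => simpa using hone1
      | succ m ih => rwa [pow_succ', mul_assoc, honeq]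
    have hsum : ∀ j : ℕ, (∑ i : ZMod (r * n) with i ∈ Q, ψ (-i) ^ j) ^ p ^ e =
        ∑ i : ZMod (r * n) with i ∈ Q, ψ (-i) ^ j := by
      intro j
      rw [sum_pow_char_pow]
      refine Finset.sum_bijective (fun i => ((p ^ e : ℕ) : ZMod (r * n)) * i)
        hq.unit.mulLeft_bijective ?_ ?_
      · intro i
        simp only [Finset.mem_filter, Finset.mem_univ, true_and]
        exact (natCast_mul_mem_cycCoset_one_iff hqd i).symm
      · intro i _
        rw [← mul_neg, hψmul, ← pow_mul, ← pow_mul, mul_comm j]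
    have hex : ∀ j : Fin n, ∃ a : F,
        algebraMap F E a = ∑ i : ZMod (r * n) with i ∈ Q, ψ (-i) ^ (j : ℕ) := fun j =>
      exists_algebraMap_eq_of_pow_card_eq (by rw [hcard]; exact hsum j)
    choose c hc using hex
    have hceval : ∀ u ∈ oneCoset r n, evalVec c (ψ u) = if u ∈ Q then (n : E) else 0 := by
      intro u hu
      simp only [evalVec, hc, Finset.sum_mul, ← mul_pow]
      rw [Finset.sum_comm]
      have h1 : ∀ i ∈ Finset.univ.filter (· ∈ Q),
          ∑ j : Fin n, (ψ (-i) * ψ u) ^ (j : ℕ) = if i = u then (n : E) else 0 := by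
        intro i hi
        have hi' := (hone i).mp (hQone i (Finset.mem_filter.mp hi).2)
        have h2 : (ψ (-i) * ψ u) ^ n = 1 := by
          rw [mul_pow, (hone u).mp hu, ← hi', ← mul_pow, hψneg, one_pow]
        rw [sum_pow_eq_ite h2]
        refine if_congr ?_ rfl rfl
        rw [← AddChar.map_add_eq_mul, ← AddChar.map_zero_eq_one ψ, hψinj.eq_iff, neg_add_eq_zero]
      rw [Finset.sum_congr rfl h1, Finset.sum_ite_eq']
      simp
    have hmem : c ∈ codeOfDefSet F n θ (oneCoset r n \ Q) := by
      rw [hcode]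
      rintro i ⟨hi, hiQ⟩
      rw [hceval i hi, if_neg hiQ]
    have hdual : c ∈ galoisDualSet (p ^ k) (codeOfDefSet F n θ (oneCoset r n \ Q)) := by
      intro x hx
      rw [hcode] at hx
      apply (algebraMap F E).injective
      rw [map_zero, map_sum]
      simp only [map_mul, map_pow, hc, sum_pow_char_pow, Finset.mul_sum]
      rw [Finset.sum_comm]
      refine Finset.sum_eq_zero fun i hi => ?_
      have hi' := (Finset.mem_filter.mp hi).2
      rw [← hx (-((p ^ k : ℕ) * i)) ⟨honek i (hQone i hi'), ?_⟩]
      · refine Finset.sum_congr rfl fun j _ => ?_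
        rw [← mul_neg, hψmul, ← pow_mul, ← pow_mul, mul_comm (p ^ k)]
      · obtain ⟨m, rfl⟩ := hi'
        intro h
        refine hk1 ((pow_mul_mem_cycCoset_one_iff hqd m _).mp ?_)
        convert h using 1
        ring
    have himg : (fun x : ZMod (r * n) => (p : ZMod (r * n)) ^ e * x) '' (oneCoset r n \ Q) =
        oneCoset r n \ Q := by
      have h : ∀ x, ((p ^ e : ℕ) : ZMod (r * n)) * x ∈ oneCoset r n \ Q ↔
          x ∈ oneCoset r n \ Q := fun x => by
        rw [Set.mem_sdiff, Set.mem_sdiff, honeq, hQ, natCast_mul_mem_cycCoset_one_iff hqd]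
      rw [← Nat.cast_pow]
      ext x
      constructor
      · rintro ⟨y, hy, rfl⟩
        exact (h y).mpr hy
      · intro hx
        obtain ⟨y, rfl⟩ := hq.unit.mulLeft_bijective.surjective x
        exact ⟨y, (h y).mp hx, rfl⟩
    have hc0 : c = 0 := by
      have h : c ∈ ({0} : Set (Fin n → F)) :=
        hLCD _ Set.sdiff_subset himg ▸ ⟨hmem, hdual⟩
      exact h
    have h1 := hceval 1 hone1
    rw [if_pos hQ1, hc0] at h1
    have h2 : (n : E) = 0 := by simpa [evalVec] using h1.symm
    rw [CharP.cast_eq_zero_iff E p] at h2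
    exact hp.one_lt.ne' (Nat.eq_one_of_dvd_coprimes hpn dvd_rfl h2)
  · rintro ⟨m, hm⟩ P hP hPq
    refine Set.eq_singleton_iff_unique_mem.mpr ⟨⟨?_, ?_⟩, ?_⟩
    · rw [hcode]
      intro i _
      simp [evalVec]
    · intro c _
      simp [hp.ne_zero]
    · rintro x ⟨hxC, hxD⟩
      have hx := (hcode P x).mp hxC
      have hzero : ∀ u ∈ oneCoset r n, evalVec x (ψ u) = 0 := by
        intro u hu
        have h1 : evalVec x (ψ (-((p ^ k : ℕ) * u))) *
            evalVec (fun j => x j ^ p ^ k) (ψ ((p ^ k : ℕ) * u)) = 0 := by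
          refine evalVec_mul_evalVec_eq_zero hlam _ _ ((hone _).mp (honek u hu)) (hψneg _) ?_
          intro a
          refine hxD _ ((hcode P _).mpr fun i hi => ?_)
          exact evalVec_shift_eq_zero hlam x ((hone i).mp (hP hi)) (hx i hi) a
        have h2 : -((p ^ k : ℕ) * u : ZMod (r * n)) = (((p ^ e) ^ m : ℕ) : ZMod (r * n)) * u := by
          push_cast at hm ⊢
          linear_combination u * hm
        rw [h2, hψmul, hψmul, evalVec_pow_card_pow hcard, ← evalVec_pow_char_pow] at h1
        rcases mul_eq_zero.mp h1 with h | h <;> exact eq_zero_of_pow_eq_zero h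
      refine eq_zero_of_evalVec_eq_zero x (fun t : Fin n => ψ (1 + (r : ZMod (r * n)) * (t : ℕ)))
        ?_ fun t => hzero _ ⟨t, t.isLt, rfl⟩
      intro s t hst
      have h1 := add_left_cancel (hψinj hst)
      have h2 : ((r * (s : ℕ) : ℕ) : ZMod (r * n)) = ((r * (t : ℕ) : ℕ) : ZMod (r * n)) := by
        exact_mod_cast h1
      rw [ZMod.natCast_eq_natCast_iff] at h2
      exact Fin.ext ((Nat.ModEq.mul_left_cancel' hr.ne' h2).eq_of_lt_of_lt s.isLt t.isLt)
end

section
/- Let p be an odd prime, q = p^e, 0 ≤ k < e, and let r, n be positive integers with n coprime to q such that the multiplicative order of p^{e−k} modulo rn equals 2. If the group of units Z_{rn}^* has a unique element of order 2 (namely the class of −1 modulo rn), then for every s ∈ 1 + rZ_{rn}, the q-cyclotomic coset Q_s modulo rn satisfies Q_s = −p^k·Q_s. -/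
/-- Multiplication by `q` permutes every `q`-cyclotomic coset when `q` has finite order. -/
theorem cycCoset_eq_image_mul {q N : ℕ} (hq : IsOfFinOrder (q : ZMod N)) (s : ZMod N) :
    cycCoset q s = (fun x : ZMod N => (q : ZMod N) * x) '' cycCoset q s := by
  obtain ⟨M, hM, hqM⟩ := isOfFinOrder_iff_pow_eq_one.mp hq
  ext x
  constructor
  · rintro ⟨m, rfl⟩
    refine ⟨_, ⟨m + (M - 1), rfl⟩, ?_⟩
    dsimp only
    rw [← mul_assoc, ← pow_succ', add_assoc, Nat.sub_add_cancel hM, pow_add, hqM, mul_one]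
  · rintro ⟨_, ⟨m, rfl⟩, rfl⟩
    exact ⟨m + 1, by rw [pow_succ', mul_assoc]⟩

/-- Let `p` be an odd prime, `q = p^e`, `0 ≤ k < e`, `gcd(n,q)=1`, `r ∣ q-1`,
and suppose the multiplicative order of `p^{e-k}` modulo `rn` is `2`.  If `-1` is the unique
element of order `2` in `Z_{rn}^*`, then `Q_s = -p^k·Q_s` for every `s ∈ 1 + rZ_{rn}`. -/
theorem stmt15 {p e k r n : ℕ} (hp : p.Prime) (hodd : Odd p) (hk : k < e)
    (hr : 0 < r) (hn : 0 < n) (hcop : Nat.Coprime n (p ^ e))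
    (hord2 : orderOf ((p : ZMod (r * n)) ^ (e - k)) = 2)
    (huniq : ∀ u : (ZMod (r * n))ˣ, orderOf u = 2 → u = -1) :
    ∀ s ∈ oneCoset r n,
      cycCoset (p ^ e) s
        = (fun x : ZMod (r * n) => -(p : ZMod (r * n)) ^ k * x) '' cycCoset (p ^ e) s := by
  have hpow : (p : ZMod (r * n)) ^ (e - k) = -1 := by
    set a := (p : ZMod (r * n)) ^ (e - k)
    have hunit : IsUnit a := IsUnit.of_pow_eq_one (hord2 ▸ pow_orderOf_eq_one a) two_ne_zero
    obtain ⟨u, hu⟩ := hunit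
    have h := huniq u (by rw [← orderOf_units, hu, hord2])
    rw [← hu, h, Units.val_neg, Units.val_one]
  have hq : -(p : ZMod (r * n)) ^ k = ((p ^ e : ℕ) : ZMod (r * n)) := by
    rw [Nat.cast_pow, ← Nat.sub_add_cancel hk.le, pow_add, hpow, neg_one_mul]
  have hfin : IsOfFinOrder ((p ^ e : ℕ) : ZMod (r * n)) := by
    have h : IsOfFinOrder ((p : ZMod (r * n)) ^ (e - k)) :=
      orderOf_pos_iff.mp (hord2 ▸ two_pos)
    rw [Nat.cast_pow]
    exact (h.of_pow (Nat.sub_ne_zero_of_lt hk)).pow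
  intro s _
  rw [hq]
  exact cycCoset_eq_image_mul hfin s
end

section
/- Let q = p^{2a} with p an odd prime, and let λ ∈ F_q^* be a primitive r-th root of unity with λ^{1+p^a} = 1, where r = 2^{b₁}·r′ with b₁ > 0 and r′ odd. Let n = 2^{b₂}·n′ with b₂ > 0 and n′ odd, and gcd(n,q) = 1. If every λ-constacyclic code of length n over F_q is Hermitian LCD, then r divides p^a + 1 and p^a + 1 ≡ 0 (mod 2^{b₁+b₂}). -/
open Finset

open Polynomial in
/-- Every element has an `n`-th root in the splitting field of `X ^ n - lam`. -/
lemma exists_splittingField_pow_eq {F : Type*} [Field F] {n : ℕ} (hn : n ≠ 0) (lam : F) :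
    ∃ μ : (X ^ n - C lam : F[X]).SplittingField, μ ^ n = algebraMap F _ lam := by
  have hs := SplittingField.splits (X ^ n - C lam : F[X])
  obtain ⟨μ, hμ⟩ := hs.exists_eval_eq_zero (by
    rw [degree_map, degree_X_pow_sub_C (Nat.pos_of_ne_zero hn)]
    exact_mod_cast hn)
  exact ⟨μ, by simpa [sub_eq_zero] using hμ⟩

/-- An odd power plus one has the same powers of two dividing it as the base plus one. -/
lemma two_pow_dvd_add_one_of_odd_pow {Q e j : ℕ} (hQ : Odd Q)
    (h : 2 ^ e ∣ Q ^ (2 * j + 1) + 1) : 2 ^ e ∣ Q + 1 := by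
  have key : ∀ j : ℕ, ∃ S : ℤ, Odd S ∧ (Q : ℤ) ^ (2 * j + 1) + 1 = (Q + 1) * S := by
    intro j
    induction j with
    | zero => exact ⟨1, odd_one, by ring⟩
    | succ j ih =>
      obtain ⟨S, hS, hSe⟩ := ih
      have hQ' : Odd (Q : ℤ) := by exact_mod_cast hQ
      refine ⟨Q ^ 2 * S - (Q - 1), ((hQ'.pow).mul hS).sub_even (hQ'.sub_odd odd_one), ?_⟩
      linear_combination (Q : ℤ) ^ 2 * hSe
  obtain ⟨S, hS, hSe⟩ := key j
  have h' : ((2 : ℤ) ^ e) ∣ (Q + 1) * S := by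
    rw [← hSe]; exact_mod_cast h
  have hc : IsCoprime ((2 : ℤ) ^ e) S :=
    IsCoprime.pow_left (Int.isCoprime_iff_gcd_eq_one.2 (Int.gcd_comm .. ▸ by
      simpa [Int.gcd, Int.natAbs_odd] using hS))
  exact_mod_cast hc.dvd_of_dvd_mul_right h'

/-- If `μ ^ n` has even order, the full power of two of `n` goes into the order of `μ`. -/
lemma two_pow_dvd_orderOf {G : Type*} [Monoid G] {μ : G} {n b₁ b₂ : ℕ} (hn : n ≠ 0)
    (hb₁ : b₁ ≠ 0) (h₁ : 2 ^ b₁ ∣ orderOf (μ ^ n)) (h₂ : 2 ^ b₂ ∣ n) :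
    2 ^ (b₁ + b₂) ∣ orderOf μ := by
  rw [orderOf_pow' μ hn] at h₁
  set m := orderOf μ
  have hg : 0 < m.gcd n := Nat.gcd_pos_of_pos_right _ (Nat.pos_of_ne_zero hn)
  have hc := Nat.coprime_div_gcd_div_gcd hg
  have hc2 : Nat.Coprime (2 ^ b₂) (n / m.gcd n) :=
    Nat.Coprime.pow_left _ (hc.coprime_dvd_left ((dvd_pow_self 2 hb₁).trans h₁))
  have h₃ : 2 ^ b₂ ∣ m.gcd n := by
    refine hc2.dvd_of_dvd_mul_right ?_
    rwa [Nat.mul_div_cancel' (Nat.gcd_dvd_right m n)]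
  rw [pow_add, ← Nat.div_mul_cancel (Nat.gcd_dvd_left m n)]
  exact mul_dvd_mul h₁ h₃

/-- The words `c` whose polynomial `∑ i, c i X ^ i` vanishes at `μ`. -/
def rootCode (F : Type*) {K : Type*} [Field F] [Field K] [Algebra F K] (n : ℕ) (μ : K) :
    Submodule F (Fin n → F) where
  carrier := {c | ∑ i, algebraMap F K (c i) * μ ^ (i : ℕ) = 0}
  zero_mem' := by simp
  add_mem' := by
    intro c d hc hd
    simp_all [add_mul, Finset.sum_add_distrib]
  smul_mem' := by
    intro s c hc
    simp_all [mul_assoc, ← Finset.mul_sum]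

lemma isConstacyclic_rootCode {F K : Type*} [Field F] [Field K] [Algebra F K] {n : ℕ}
    {lam : F} {μ : K} (hμ : μ ^ n = algebraMap F K lam) :
    IsConstacyclic lam (rootCode F n μ) := by
  intro c hc
  change ∑ i, algebraMap F K (c i) * μ ^ (i : ℕ) = 0 at hc
  change ∑ i, algebraMap F K (constaShift lam c i) * μ ^ (i : ℕ) = 0
  rcases n with _ | n
  · simp
  rw [Fin.sum_univ_castSucc] at hc
  rw [Fin.sum_univ_succ]
  have h0 : constaShift lam c 0 = lam * c (Fin.last n) := by
    simp [constaShift, Fin.last]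
  have hs : ∀ i : Fin n, constaShift lam c i.succ = c i.castSucc := by
    intro i
    simp [constaShift, Fin.castSucc, Fin.castAdd, Fin.castLE]
  simp only [h0, hs, map_mul, ← hμ, Fin.val_zero, Fin.val_succ, pow_zero, mul_one]
  simp only [Fin.val_castSucc, Fin.val_last] at hc
  calc _ = μ * (∑ i : Fin n, algebraMap F K (c i.castSucc) * μ ^ (i : ℕ)
        + algebraMap F K (c (Fin.last n)) * μ ^ n) := by
        rw [mul_add, Finset.mul_sum, add_comm]
        congr 1
        · exact Finset.sum_congr rfl fun i _ => by ring
        · ring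
    _ = 0 := by rw [hc, mul_zero]

/-- If the code of words vanishing at `μ` is Hermitian LCD, then `μ⁻¹` is a conjugate of
`μ ^ Q`, where `F` has `Q ^ 2` elements. -/
lemma exists_pow_eq_one_of_rootCode_inter_dual {F K : Type*} [Field F] [Fintype F] [Field K]
    [Algebra F K] [FiniteDimensional F K] {p a n : ℕ} (hp : p.Prime)
    (hcard : Fintype.card F = p ^ (2 * a)) (hn : n ≠ 0) {lam : F}
    (hlam : lam ^ (1 + p ^ a) = 1) {μ : K} (hμ : μ ^ n = algebraMap F K lam)
    (h : (rootCode F n μ : Set (Fin n → F)) ∩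
      galoisDualSet (p ^ a) (rootCode F n μ : Set (Fin n → F)) = {0}) :
    ∃ j : ℕ, μ ^ ((p ^ a) ^ (2 * j + 1) + 1) = 1 := by
  by_contra! hne
  have : Fact p.Prime := ⟨hp⟩
  have hcF : Nat.card F = (p ^ a) ^ 2 := by
    rw [Nat.card_eq_fintype_card, hcard, ← pow_mul, mul_comm]
  have : CharP F p := charP_of_card_eq_prime_pow hcard
  have : CharP K p := charP_of_injective_algebraMap (algebraMap F K).injective p
  have : Finite K := Module.finite_of_finite F
  set Q := p ^ a with hQ
  have hsum : ∀ j : ℕ, ∑ i : Fin n, (μ ^ (Q ^ (2 * j + 1) + 1)) ^ (i : ℕ) = 0 := by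
    intro j
    have hpow : (μ ^ (Q ^ (2 * j + 1) + 1)) ^ n = 1 := by
      obtain ⟨t, ht⟩ : Q + 1 ∣ Q ^ (2 * j + 1) + 1 := by
        simpa using Odd.nat_add_dvd_pow_add_pow Q 1 (n := 2 * j + 1) ⟨j, rfl⟩
      rw [← pow_mul, mul_comm, pow_mul, hμ, ht, pow_mul, ← map_pow, add_comm, hlam]
      simp
    rw [Fin.sum_univ_eq_sum_range (fun i => (μ ^ (Q ^ (2 * j + 1) + 1)) ^ i)]
    have := geom_sum_mul (μ ^ (Q ^ (2 * j + 1) + 1)) n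
    rw [hpow, sub_self] at this
    exact (mul_eq_zero.1 this).resolve_right (sub_ne_zero.2 (hne j))
  have htr : ∀ β : K, Algebra.trace F K β = 0 := by
    intro β
    let x : Fin n → F := fun i => Algebra.trace F K (β * μ ^ (i : ℕ)) ^ Q
    have hx : x ∈ (rootCode F n μ : Set (Fin n → F)) ∩
        galoisDualSet Q (rootCode F n μ : Set (Fin n → F)) := by
      constructor
      · change ∑ i : Fin n, algebraMap F K (x i) * μ ^ (i : ℕ) = 0
        have hxi : ∀ i : Fin n, algebraMap F K (x i) * μ ^ (i : ℕ) =
            ∑ j ∈ Finset.range (Module.finrank F K),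
              β ^ Q ^ (2 * j + 1) * (μ ^ (Q ^ (2 * j + 1) + 1)) ^ (i : ℕ) := by
          intro i
          simp only [x]
          rw [map_pow, FiniteField.algebraMap_trace_eq_sum_pow, hQ, sum_pow_char_pow, ← hQ,
            Finset.sum_mul]
          refine Finset.sum_congr rfl fun j _ => ?_
          rw [hcF, ← pow_mul, ← pow_mul Q, ← pow_succ, mul_pow, mul_assoc]
          ring
        simp only [hxi]
        rw [Finset.sum_comm]
        exact Finset.sum_eq_zero fun j _ => by rw [← Finset.mul_sum, hsum, mul_zero]
      · intro c hc
        change ∑ i, algebraMap F K (c i) * μ ^ (i : ℕ) = 0 at hc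
        have hxQ : ∀ i, x i ^ Q = Algebra.trace F K (β * μ ^ (i : ℕ)) := by
          intro i
          simp only [x]
          rw [← pow_mul, ← pow_two, ← hcF, Nat.card_eq_fintype_card, FiniteField.pow_card]
        calc ∑ i, c i * x i ^ Q
            = Algebra.trace F K (β * ∑ i, algebraMap F K (c i) * μ ^ (i : ℕ)) := by
              rw [Finset.mul_sum, map_sum]
              refine Finset.sum_congr rfl fun i _ => ?_
              rw [hxQ, mul_left_comm, ← Algebra.smul_def, map_smul, smul_eq_mul]
          _ = 0 := by rw [hc, mul_zero, map_zero]
    rw [h, Set.mem_singleton_iff] at hx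
    have := congrFun hx ⟨0, Nat.pos_of_ne_zero hn⟩
    simpa [x, hQ, hp.ne_zero] using this
  exact Algebra.trace_ne_zero F K (LinearMap.ext htr)

/-- Let `q = p^{2a}` with `p` an odd prime, and `λ ∈ F_q^*` a primitive `r`-th
root of unity with `λ^{1+p^a} = 1`, where `r = 2^{b₁} r'` (`b₁ > 0`, `r'` odd),
`n = 2^{b₂} n'` (`b₂ > 0`, `n'` odd), `gcd(n,q)=1`.  If every `λ`-constacyclic code of
length `n` over `F_q` is Hermitian LCD, then `r ∣ p^a + 1` and `2^{b₁+b₂} ∣ p^a + 1`. -/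
theorem stmt16 {p a r n b1 b2 r' n' : ℕ} (hp : p.Prime) (hodd : Odd p) (ha : 0 < a)
    {F : Type*} [Field F] [Fintype F] (hcard : Fintype.card F = p ^ (2 * a))
    (lam : F) (hlam : lam ≠ 0) (hord : orderOf lam = r)
    (hlam1 : lam ^ (1 + p ^ a) = 1)
    (hr : r = 2 ^ b1 * r') (hb1 : 0 < b1) (hr' : Odd r')
    (hn : n = 2 ^ b2 * n') (hb2 : 0 < b2) (hn' : Odd n')
    (hcop : Nat.Coprime n (p ^ (2 * a)))
    (hall : ∀ C : Submodule F (Fin n → F), IsConstacyclic lam C →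
      (C : Set (Fin n → F)) ∩ galoisDualSet (p ^ a) (C : Set (Fin n → F)) = {0}) :
    r ∣ p ^ a + 1 ∧ 2 ^ (b1 + b2) ∣ p ^ a + 1 := by
  refine ⟨hord ▸ orderOf_dvd_of_pow_eq_one (by rwa [add_comm]), ?_⟩
  have hn0 : n ≠ 0 := by
    rw [hn]
    exact mul_ne_zero (by positivity) hn'.pos.ne'
  obtain ⟨μ, hμ⟩ := exists_splittingField_pow_eq hn0 lam
  obtain ⟨j, hj⟩ := exists_pow_eq_one_of_rootCode_inter_dual hp hcard hn0 hlam1 hμ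
    (hall _ (isConstacyclic_rootCode hμ))
  refine two_pow_dvd_add_one_of_odd_pow hodd.pow
    ((two_pow_dvd_orderOf hn0 hb1.ne' ?_ ?_).trans (orderOf_dvd_of_pow_eq_one hj))
  · have hord' := orderOf_injective
      (algebraMap F (Polynomial.X ^ n - Polynomial.C lam).SplittingField).toMonoidHom
      (algebraMap F _).injective lam
    rw [hμ]
    refine Dvd.dvd.trans ?_ hord'.symm.dvd
    rw [hord, hr]
    exact dvd_mul_right _ _
  · rw [hn]
    exact dvd_mul_right _ _
end

section
/- Let p be an odd prime, q = p^{2a}, and let r, n be positive integers with n coprime to q such that the multiplicative order of p^a modulo rn equals 2(1+2j) for some nonnegative integer j. If the group of units Z_{rn}^* has a unique element of order 2 (namely the class of −1 modulo rn), then for every i with 0 ≤ i ≤ n−1, the q-cyclotomic coset Q_{1+ri} modulo rn satisfies −p^a·Q_{1+ri} = Q_{1+ri}, and moreover |Q_1| = 1 + 2j. -/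
/-- If `-1` is the only unit of order `2`, an element of order `2m` with `m > 0` has `m`-th
power `-1`. -/
theorem pow_eq_neg_one_of_orderOf_eq_two_mul {R : Type*} [Ring R] {x : R} {m : ℕ} (hm : 0 < m)
    (hx : orderOf x = 2 * m) (huniq : ∀ u : Rˣ, orderOf u = 2 → u = -1) : x ^ m = -1 := by
  have hpow : orderOf (x ^ m) = 2 := by
    rw [orderOf_pow_of_dvd hm.ne' (hx ▸ Dvd.intro_left 2 rfl), hx, Nat.mul_div_cancel _ hm]
  have hfin : IsOfFinOrder (x ^ m) := orderOf_pos_iff.mp (by omega)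
  obtain ⟨u, hu⟩ := hfin.isUnit
  have h : u = -1 := huniq u (by rw [← orderOf_units, hu, hpow])
  rw [← hu, h, Units.val_neg, Units.val_one]

/-- The coset of `1` has as many elements as the order of `q`, if that order is finite. -/
theorem ncard_cycCoset_one {q N : ℕ} (hq : 0 < orderOf (q : ZMod N)) :
    (cycCoset q (1 : ZMod N)).ncard = orderOf (q : ZMod N) := by
  have h : cycCoset q (1 : ZMod N) =
      (fun m : ℕ => (q : ZMod N) ^ m) '' Set.Iio (orderOf (q : ZMod N)) := by
    ext x
    constructor
    · rintro ⟨m, rfl⟩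
      exact ⟨m % orderOf (q : ZMod N), Nat.mod_lt _ hq, by simp only [pow_mod_orderOf, mul_one]⟩
    · rintro ⟨m, -, rfl⟩
      exact ⟨m, (mul_one _).symm⟩
  rw [h, pow_injOn_Iio_orderOf.ncard_image, Set.ncard_Iio_nat]

/-- Multiplication by a power of `q` permutes a `q`-cyclotomic coset when `q` has finite
order. -/
theorem image_pow_mul_cycCoset {q N k l : ℕ} (s : ZMod N) (h : (q : ZMod N) ^ (k + l) = 1) :
    (fun x => (q : ZMod N) ^ k * x) '' cycCoset q s = cycCoset q s := by
  ext x
  constructor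
  · rintro ⟨_, ⟨m, rfl⟩, rfl⟩
    exact ⟨k + m, by ring⟩
  · rintro ⟨m, rfl⟩
    refine ⟨(q : ZMod N) ^ (l + m) * s, ⟨l + m, rfl⟩, ?_⟩
    calc (q : ZMod N) ^ k * ((q : ZMod N) ^ (l + m) * s)
        = (q : ZMod N) ^ (k + l) * ((q : ZMod N) ^ m * s) := by ring
      _ = (q : ZMod N) ^ m * s := by rw [h, one_mul]

/-- Let `p` be an odd prime, `q = p^{2a}`, `gcd(n,q)=1`, and suppose the
multiplicative order of `p^a` modulo `rn` is `2(1+2j)`.  If `-1` is the unique element of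
order `2` in `Z_{rn}^*`, then `-p^a·Q_{1+ri} = Q_{1+ri}` for `0 ≤ i ≤ n-1`, and
`|Q_1| = 1 + 2j`. -/
theorem stmt18 {p a r n j : ℕ} (hp : p.Prime) (hodd : Odd p) (ha : 0 < a)
    (hr : 0 < r) (hn : 0 < n) (hcop : Nat.Coprime n (p ^ (2 * a)))
    (hord : orderOf ((p : ZMod (r * n)) ^ a) = 2 * (1 + 2 * j))
    (huniq : ∀ u : (ZMod (r * n))ˣ, orderOf u = 2 → u = -1) :
    (∀ i : ℕ, i < n →
      (fun x : ZMod (r * n) => -(p : ZMod (r * n)) ^ a * x) ''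
          cycCoset (p ^ (2 * a)) (1 + (r : ZMod (r * n)) * (i : ZMod (r * n)))
        = cycCoset (p ^ (2 * a)) (1 + (r : ZMod (r * n)) * (i : ZMod (r * n)))) ∧
    Set.ncard (cycCoset (p ^ (2 * a)) (1 : ZMod (r * n))) = 1 + 2 * j := by
  have hneg := pow_eq_neg_one_of_orderOf_eq_two_mul (by omega) hord huniq
  have hq : ((p ^ (2 * a) : ℕ) : ZMod (r * n)) = ((p : ZMod (r * n)) ^ a) ^ 2 := by
    push_cast
    ring
  have hmul : -(p : ZMod (r * n)) ^ a = ((p ^ (2 * a) : ℕ) : ZMod (r * n)) ^ (j + 1) := by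
    calc -(p : ZMod (r * n)) ^ a = (-1) * (p : ZMod (r * n)) ^ a := by ring
      _ = ((p ^ (2 * a) : ℕ) : ZMod (r * n)) ^ (j + 1) := by rw [← hneg, hq]; ring
  constructor
  · intro i _
    rw [hmul]
    refine image_pow_mul_cycCoset (l := j) _ ?_
    rw [hq, ← pow_mul, show 2 * (j + 1 + j) = 2 * (1 + 2 * j) by ring, ← hord,
      pow_orderOf_eq_one]
  · have hordq : orderOf ((p ^ (2 * a) : ℕ) : ZMod (r * n)) = 1 + 2 * j := by
      rw [hq, orderOf_pow_of_dvd two_ne_zero (hord ▸ Dvd.intro _ rfl), hord,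
        Nat.mul_div_cancel_left _ two_pos]
    rw [ncard_cycCoset_one (by omega), hordq]
end

section
/- Let p be an odd prime, q = p^{2a}, λ ∈ F_q^* with order r and λ^{1+p^a} = 1, and n coprime to q. Suppose the multiplicative order of p^a modulo rn equals 2 and the group of units Z_{rn}^* has a unique element of order 2 (namely the class of −1 modulo rn). Then for every d with 2 ≤ d ≤ n, there exists a Hermitian LCD λ-constacyclic code of length n over F_q that is MDS with parameters [n, n+1−d, d]. -/
open Finset

open Polynomial in
/-- The linear map sending a polynomial `P` to the vector `(γ ^ i * P(ξ ^ i))_i`. -/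
noncomputable def twistedEval {F : Type*} [Field F] (n : ℕ) (γ ξ : F) :
    F[X] →ₗ[F] (Fin n → F) where
  toFun P i := γ ^ (i : ℕ) * P.eval (ξ ^ (i : ℕ))
  map_add' P R := by
    ext i
    simp [mul_add]
  map_smul' c P := by
    ext i
    simp [mul_left_comm]

theorem twistedEval_apply {F : Type*} [Field F] (n : ℕ) (γ ξ : F) (P : Polynomial F)
    (i : Fin n) : twistedEval n γ ξ P i = γ ^ (i : ℕ) * P.eval (ξ ^ (i : ℕ)) := rfl

/-- The code of all vectors `(γ ^ i * P(ξ ^ i))_i` with `P` of degree less than `m`. -/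
noncomputable def twistedCode {F : Type*} [Field F] (n m : ℕ) (γ ξ : F) :
    Submodule F (Fin n → F) :=
  (Polynomial.degreeLT F m).map (twistedEval n γ ξ)

theorem twistedCode_isConstacyclic {F : Type*} [Field F] {n m : ℕ} {lam γ ξ : F}
    (hγ : γ ≠ 0) (hξ : ξ ≠ 0) (hγn : lam * γ ^ n = 1) (hξn : ξ ^ n = 1) :
    IsConstacyclic lam (twistedCode n m γ ξ) := by
  rintro _ ⟨P, hP, rfl⟩
  refine ⟨Polynomial.C γ⁻¹ * P.comp (Polynomial.C ξ⁻¹ * Polynomial.X), ?_, ?_⟩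
  · simp only [SetLike.mem_coe, Polynomial.mem_degreeLT] at hP ⊢
    rw [Polynomial.degree_C_mul (inv_ne_zero hγ)]
    rw [Polynomial.degree_lt_iff_coeff_zero] at hP ⊢
    intro k hk
    rw [Polynomial.comp_C_mul_X_coeff, hP k hk, zero_mul]
  · ext i
    have hi := i.isLt
    simp only [twistedEval_apply, constaShift, Polynomial.eval_mul, Polynomial.eval_C,
      Polynomial.eval_comp, Polynomial.eval_X]
    split_ifs with h0
    · obtain ⟨k, rfl⟩ : ∃ k, n = k + 1 := ⟨n - 1, by omega⟩
      have h1 : ξ ^ k = ξ⁻¹ := eq_inv_of_mul_eq_one_left (by rwa [← pow_succ])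
      have h2 : lam * γ ^ k = γ⁻¹ :=
        eq_inv_of_mul_eq_one_left (by rw [mul_assoc, ← pow_succ, hγn])
      simp [h0, h1, ← h2, mul_assoc]
    · obtain ⟨k, hk⟩ : ∃ k, (i : ℕ) = k + 1 := ⟨i - 1, by omega⟩
      simp only [hk, Nat.add_sub_cancel, pow_succ']
      rw [inv_mul_cancel_left₀ hξ]
      field_simp

theorem card_filter_eval_pow_eq_zero_le {F : Type*} [Field F] [DecidableEq F] {n : ℕ} {ξ : F}
    (hξ : IsPrimitiveRoot ξ n) {P : Polynomial F} (hP : P ≠ 0) :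
    #{i : Fin n | P.eval (ξ ^ (i : ℕ)) = 0} ≤ P.natDegree := by
  refine le_trans ?_ (P.card_roots' |>.trans' (Multiset.toFinset_card_le _))
  refine card_le_card_of_injOn (fun i : Fin n => ξ ^ (i : ℕ)) ?_ ?_
  · intro i hi
    simp at hi
    simp [hP, hi]
  · intro i _ j _ hij
    exact Fin.ext (hξ.pow_inj i.isLt j.isLt hij)

theorem hammingNorm_twistedEval {F : Type*} [Field F] [DecidableEq F] {n : ℕ} {γ ξ : F}
    (hγ : γ ≠ 0) (P : Polynomial F) :
    hammingNorm (twistedEval n γ ξ P) + #{i : Fin n | P.eval (ξ ^ (i : ℕ)) = 0} = n := by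
  have h := card_filter_add_card_filter_not (s := (univ : Finset (Fin n)))
    (fun i => P.eval (ξ ^ (i : ℕ)) = 0)
  simp only [card_univ, Fintype.card_fin] at h
  have h2 : hammingNorm (twistedEval n γ ξ P) =
      #{i : Fin n | ¬ P.eval (ξ ^ (i : ℕ)) = 0} := by
    simp [hammingNorm, twistedEval_apply, hγ]
  omega

theorem natDegree_lt_of_mem_degreeLT {F : Type*} [Field F] {m : ℕ} (hm : 0 < m)
    {P : Polynomial F} (hP : P ∈ Polynomial.degreeLT F m) : P.natDegree < m := by
  rcases eq_or_ne P 0 with rfl | hP0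
  · simpa using hm
  · rwa [Polynomial.natDegree_lt_iff_degree_lt hP0, ← Polynomial.mem_degreeLT]

theorem finrank_twistedCode {F : Type*} [Field F] {n m : ℕ} {γ ξ : F}
    (hγ : γ ≠ 0) (hξ : IsPrimitiveRoot ξ n) (hm : 0 < m) (hmn : m ≤ n) :
    Module.finrank F (twistedCode n m γ ξ) = m := by
  classical
  have hinj : Function.Injective
      ((twistedEval n γ ξ).domRestrict (Polynomial.degreeLT F m)) := by
    rw [injective_iff_map_eq_zero]
    rintro ⟨P, hP⟩ h
    by_contra hne
    have hP0 : P ≠ 0 := fun h => hne (Subtype.ext h)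
    have h1 := card_filter_eval_pow_eq_zero_le hξ hP0
    have h2 := hammingNorm_twistedEval (n := n) (ξ := ξ) hγ P
    have h3 := natDegree_lt_of_mem_degreeLT hm hP
    rw [LinearMap.domRestrict_apply] at h
    rw [h, hammingNorm_zero] at h2
    omega
  have h := LinearMap.finrank_range_of_inj hinj
  rw [LinearMap.range_domRestrict] at h
  rw [twistedCode, h, (Polynomial.degreeLTEquiv F m).finrank_eq, Module.finrank_fin_fun]

theorem isLeast_hammingNorm_twistedCode {F : Type*} [Field F] [DecidableEq F] {n m : ℕ}
    {γ ξ : F} (hγ : γ ≠ 0) (hξ : IsPrimitiveRoot ξ n) (hm : 0 < m) (hmn : m ≤ n) :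
    IsLeast {w | ∃ c ∈ twistedCode n m γ ξ, c ≠ 0 ∧ hammingNorm c = w} (n + 1 - m) := by
  have lower : ∀ P ∈ Polynomial.degreeLT F m, P ≠ 0 →
      n + 1 - m ≤ hammingNorm (twistedEval n γ ξ P) := by
    intro P hP hP0
    have h1 := card_filter_eval_pow_eq_zero_le hξ hP0
    have h2 := hammingNorm_twistedEval (n := n) (ξ := ξ) hγ P
    have h3 := natDegree_lt_of_mem_degreeLT hm hP
    omega
  constructor
  · let P : Polynomial F := ∏ j ∈ range (m - 1), (Polynomial.X - Polynomial.C (ξ ^ j))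
    have hmonic : P.Monic := Polynomial.monic_prod_of_monic _ _ fun j _ => Polynomial.monic_X_sub_C _
    have hdeg : P.natDegree = m - 1 := by
      rw [Polynomial.natDegree_prod_of_monic _ _ fun j _ => Polynomial.monic_X_sub_C _]
      simp only [Polynomial.natDegree_X_sub_C, sum_const, card_range, smul_eq_mul, mul_one]
    have hP : P ∈ Polynomial.degreeLT F m := by
      rw [Polynomial.mem_degreeLT, Polynomial.degree_eq_natDegree hmonic.ne_zero, hdeg]
      exact_mod_cast Nat.sub_lt hm one_pos
    have h1 := lower P hP hmonic.ne_zero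
    have h2 := hammingNorm_twistedEval (n := n) (ξ := ξ) hγ P
    have h3 : m - 1 ≤ #{i : Fin n | P.eval (ξ ^ (i : ℕ)) = 0} := by
      rw [← card_range (m - 1)]
      refine card_le_card_of_surjOn (fun i : Fin n => (i : ℕ)) ?_
      intro j hj
      simp only [coe_range, Set.mem_Iio] at hj
      refine ⟨⟨j, by omega⟩, ?_, rfl⟩
      simp only [coe_filter, mem_univ, true_and, Set.mem_ofPred_eq, P, Polynomial.eval_prod]
      exact prod_eq_zero (mem_range.2 hj) (by simp)
    refine ⟨_, ⟨P, hP, rfl⟩, fun h => ?_, by omega⟩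
    rw [h, hammingNorm_zero] at h1
    omega
  · rintro w ⟨_, ⟨P, hP, rfl⟩, hne, rfl⟩
    exact lower P hP fun h => hne (by rw [h, map_zero])

theorem sum_pow_mul_inv_pow {F : Type*} [Field F] {n : ℕ} {ξ : F}
    (hξ : IsPrimitiveRoot ξ n) {j k : ℕ} (hj : j < n) (hk : k < n) :
    ∑ i : Fin n, (ξ ^ k * (ξ ^ j)⁻¹) ^ (i : ℕ) = if j = k then (n : F) else 0 := by
  have hξ0 : ξ ≠ 0 := hξ.ne_zero (by omega)
  split_ifs with h
  · subst h
    simp [hξ0]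
  · rw [Fin.sum_univ_eq_sum_range (fun i => (ξ ^ k * (ξ ^ j)⁻¹) ^ i)]
    have hne : ξ ^ k * (ξ ^ j)⁻¹ ≠ 1 := fun h1 =>
      h (hξ.pow_inj hk hj (mul_inv_eq_one₀ (pow_ne_zero _ hξ0) |>.1 h1)).symm
    rw [geom_sum_eq hne, mul_pow, inv_pow, pow_right_comm, pow_right_comm ξ j, hξ.pow_eq_one]
    simp

theorem twistedCode_inter_galoisDualSet {F : Type*} [Field F] {n m p a : ℕ} [Fact p.Prime]
    [CharP F p] {γ ξ : F} (hξ : IsPrimitiveRoot ξ n) (hm : 0 < m) (hmn : m ≤ n)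
    (hn : (n : F) ≠ 0) (hγ1 : γ * γ ^ p ^ a = 1) (hξ1 : ξ * ξ ^ p ^ a = 1) :
    (twistedCode n m γ ξ : Set (Fin n → F)) ∩
      galoisDualSet (p ^ a) (twistedCode n m γ ξ : Set (Fin n → F)) = {0} := by
  refine Set.Subset.antisymm ?_ ?_
  · rintro _ ⟨⟨P, hP, rfl⟩, hdual⟩
    have hdeg := natDegree_lt_of_mem_degreeLT hm hP
    have hinv : ξ ^ p ^ a = ξ⁻¹ := eq_inv_of_mul_eq_one_right hξ1
    suffices h : P = 0 by rw [h, map_zero]; rfl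
    ext k
    rw [Polynomial.coeff_zero]
    rcases le_or_gt m k with hk | hk
    · exact Polynomial.coeff_eq_zero_of_natDegree_lt (by omega)
    have hX : (Polynomial.X ^ k : Polynomial F) ∈ Polynomial.degreeLT F m := by
      rw [Polynomial.mem_degreeLT, Polynomial.degree_X_pow]
      exact_mod_cast hk
    have hsum := hdual _ ⟨_, hX, rfl⟩
    have hterm : ∀ i : Fin n, twistedEval n γ ξ (Polynomial.X ^ k) i *
        twistedEval n γ ξ P i ^ p ^ a =
        ∑ j ∈ range m, P.coeff j ^ p ^ a * (ξ ^ k * (ξ ^ j)⁻¹) ^ (i : ℕ) := by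
      intro i
      have hγi : γ ^ (i : ℕ) * (γ ^ (i : ℕ)) ^ p ^ a = 1 := by
        rw [pow_right_comm, ← mul_pow, hγ1, one_pow]
      rw [twistedEval_apply, twistedEval_apply, Polynomial.eval_eq_sum_range' hdeg, mul_pow,
        sum_pow_char_pow, Polynomial.eval_pow, Polynomial.eval_X, mul_mul_mul_comm, hγi, one_mul,
        mul_sum]
      refine sum_congr rfl fun j _ => ?_
      rw [mul_pow, pow_right_comm (ξ ^ (i : ℕ)), pow_right_comm ξ (i : ℕ) (p ^ a), hinv]
      simp only [inv_pow, mul_pow, ← pow_mul]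
      rw [mul_comm k, mul_comm j]
      ring
    rw [sum_congr rfl fun i _ => hterm i, sum_comm] at hsum
    simp only [← mul_sum] at hsum
    rw [sum_congr rfl fun j hj => by
      rw [sum_pow_mul_inv_pow hξ ((mem_range.1 hj).trans_le hmn) (hk.trans_le hmn)]] at hsum
    simp only [mul_ite, mul_zero, sum_ite_eq', mem_range, hk, if_true] at hsum
    exact eq_zero_of_pow_eq_zero ((mul_eq_zero.1 hsum).resolve_right hn)
  · rintro _ rfl
    have := Fact.out (p := p.Prime)
    exact ⟨zero_mem _, fun c _ => by simp [this.ne_zero]⟩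

theorem dvd_pow_add_one_of_unique_order_two {N x : ℕ} (hx : orderOf (x : ZMod N) = 2)
    (huniq : ∀ u : (ZMod N)ˣ, orderOf u = 2 → u = -1) : N ∣ x + 1 := by
  have hsq : (x : ZMod N) ^ 2 = 1 := by rw [← hx, pow_orderOf_eq_one]
  have h := congrArg Units.val (huniq (Units.ofPowEqOne _ 2 hsq two_ne_zero) (by
    rw [← orderOf_units, Units.val_ofPowEqOne, hx]))
  rw [Units.val_ofPowEqOne, Units.val_neg, Units.val_one] at h
  rw [← ZMod.natCast_eq_zero_iff, Nat.cast_add, h, Nat.cast_one, neg_add_cancel]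

theorem exists_isPrimitiveRoot_of_dvd_card_sub_one {F : Type*} [Field F] [Fintype F] {N : ℕ}
    (hN : N ∣ Fintype.card F - 1) : ∃ β : F, IsPrimitiveRoot β N := by
  classical
  obtain ⟨g, hg⟩ := IsCyclic.exists_ofOrder_eq_natCard (α := Fˣ)
  rw [Nat.card_eq_fintype_card, Fintype.card_units] at hg
  have hpos : 0 < Fintype.card F - 1 := Nat.sub_pos_of_lt Fintype.one_lt_card
  obtain ⟨k, hk⟩ := hN
  refine ⟨(g : F) ^ k, (IsPrimitiveRoot.coe_units_iff.2 (IsPrimitiveRoot.orderOf g)).pow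
    (by omega) (by rw [hg, hk, mul_comm])⟩

/-- Let `p` be an odd prime, `q = p^{2a}`, `λ ∈ F_q^*` of order `r` with
`λ^{1+p^a} = 1`, `gcd(n,q)=1`.  Suppose the multiplicative order of `p^a` modulo `rn` is `2`
and `-1` is the unique element of order `2` in `Z_{rn}^*`.  Then for every `2 ≤ d ≤ n` there
is a Hermitian LCD MDS `λ`-constacyclic code of length `n` over `F_q` with parameters
`[n, n+1-d, d]`. -/
theorem stmt19 {p a r n : ℕ} (hp : p.Prime) (hodd : Odd p) (ha : 0 < a)
    {F : Type*} [Field F] [Fintype F] [DecidableEq F]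
    (hcard : Fintype.card F = p ^ (2 * a))
    (lam : F) (hlam : lam ≠ 0) (hord : orderOf lam = r)
    (hlam1 : lam ^ (1 + p ^ a) = 1)
    (hn : 0 < n) (hcop : Nat.Coprime n (p ^ (2 * a)))
    (hord2 : orderOf ((p : ZMod (r * n)) ^ a) = 2)
    (huniq : ∀ u : (ZMod (r * n))ˣ, orderOf u = 2 → u = -1) :
    ∀ d : ℕ, 2 ≤ d → d ≤ n →
      ∃ C : Submodule F (Fin n → F), IsConstacyclic lam C ∧
        (C : Set (Fin n → F)) ∩ galoisDualSet (p ^ a) (C : Set (Fin n → F)) = {0} ∧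
        Module.finrank F C = n + 1 - d ∧
        IsLeast {w | ∃ c ∈ C, c ≠ 0 ∧ hammingNorm c = w} d := by
  have hr : 0 < r := hord ▸ orderOf_pos_iff.2
    (isOfFinOrder_iff_pow_eq_one.2 ⟨Fintype.card F - 1,
      Nat.sub_pos_of_lt Fintype.one_lt_card, FiniteField.pow_card_sub_one_eq_one lam hlam⟩)
  have : Fact p.Prime := ⟨hp⟩
  have : CharP F p := by
    obtain ⟨p', hp'⟩ := CharP.exists F
    obtain ⟨k, hk, hc⟩ := FiniteField.card F p'
    have : p' = p := (Nat.prime_dvd_prime_iff_eq hk hp).1 <| hk.dvd_of_dvd_pow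
      (n := 2 * a) (by rw [← hcard, hc]; exact dvd_pow_self _ k.ne_zero)
    exact this ▸ hp'
  have hdvd : r * n ∣ p ^ a + 1 :=
    dvd_pow_add_one_of_unique_order_two (by rw [Nat.cast_pow]; exact hord2) huniq
  obtain ⟨β, hβ⟩ := exists_isPrimitiveRoot_of_dvd_card_sub_one (F := F) (N := r * n) (by
    rw [hcard, mul_comm 2 a, pow_mul, ← one_pow 2, Nat.sq_sub_sq]
    exact hdvd.mul_right _)
  have hrn : 0 < r * n := Nat.mul_pos hr hn
  have hβ0 : β ≠ 0 := hβ.ne_zero hrn.ne'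
  have hβ1 : β * β ^ p ^ a = 1 := by
    rw [← pow_succ']
    exact (hβ.pow_eq_one_iff_dvd _).2 hdvd
  have hpow : ∀ k : ℕ, β ^ k * (β ^ k) ^ p ^ a = 1 := fun k => by
    rw [pow_right_comm, ← mul_pow, hβ1, one_pow]
  have hξ : IsPrimitiveRoot (β ^ r) n := hβ.pow hrn rfl
  have hn0 : (n : F) ≠ 0 := by
    rw [Ne, CharP.cast_eq_zero_iff F p]
    exact fun h => hp.one_lt.ne' (Nat.eq_one_of_dvd_coprimes hcop h (dvd_pow_self _ (by omega)))
  have : NeZero r := ⟨hr.ne'⟩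
  obtain ⟨k, -, hk⟩ := (hβ.pow hrn (mul_comm r n)).eq_pow_of_pow_eq_one
    (ξ := lam⁻¹) (by rw [inv_pow, ← hord, pow_orderOf_eq_one, inv_one])
  have hγn : lam * (β ^ k) ^ n = 1 := by
    rw [pow_right_comm, hk, mul_inv_cancel₀ hlam]
  intro d hd hdn
  have hγ0 : β ^ k ≠ 0 := pow_ne_zero _ hβ0
  have hm : 0 < n + 1 - d := by omega
  have hmn : n + 1 - d ≤ n := by omega
  refine ⟨twistedCode n (n + 1 - d) (β ^ k) (β ^ r),
    twistedCode_isConstacyclic hγ0 (pow_ne_zero _ hβ0) hγn hξ.pow_eq_one,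
    twistedCode_inter_galoisDualSet hξ hm hmn hn0 (hpow k) (hpow r),
    finrank_twistedCode hγ0 hξ hm hmn, ?_⟩
  have hleast := isLeast_hammingNorm_twistedCode hγ0 hξ hm hmn
  rwa [show n + 1 - (n + 1 - d) = d by omega] at hleast
end
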